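/- Let H̃_n be the height of a random admissible walk of length n on ℤ. Its variance V H̃_n = E H̃_n² − (E H̃_n)², where E H̃_n^r = (Σ_{h≥0} h^r W(n,h))/(Σ_{h≥0} W(n,h)), satisfies, as n → ∞, V H̃_n = ((28ζ(3) − π³)/8) n + (224ζ(3) − 9π³)/48 − (1792ζ(3) − 67π³)/(2880n) + (107520ζ(3) − 4189π³)/(120960 n²) + O(n^{−3}), where ζ(3) = Σ_{k≥1} k^{−3} is Apéry's constant. -/

import Mathlib

open Real

/-- Partial sum `S_k` of the `±1`-walk encoded by `ε : Fin n → Bool`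
(`true` = step `+1`, `false` = step `-1`). -/
def walkSum (n : ℕ) (ε : Fin n → Bool) (k : ℕ) : ℤ :=
  ∑ i : Fin n, if (i : ℕ) < k then (if ε i then 1 else -1) else 0

/-- `W n h`: number of `±1`-paths of length `n` with `0 ≤ S_k ≤ h` for all `k` and `S_n = h`. -/
noncomputable def W (n h : ℕ) : ℕ :=
  Nat.card {ε : Fin n → Bool //
    (∀ k ≤ n, 0 ≤ walkSum n ε k ∧ walkSum n ε k ≤ (h : ℤ)) ∧ walkSum n ε n = (h : ℤ)}

/-- The `r`-th moment `E H̃_n^r = (Σ_h h^r·W(n,h))/(Σ_h W(n,h))` of the height of a random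
admissible walk on `ℤ`. -/
noncomputable def heightMomentZ (n r : ℕ) : ℝ :=
  (∑' h : ℕ, (h : ℝ) ^ r * (W n h : ℝ)) / (∑' h : ℕ, (W n h : ℝ))

/-- The variance `V H̃_n = E H̃_n² − (E H̃_n)²` of the height of a random admissible walk
on `ℤ`. -/
noncomputable def heightVarZ (n : ℕ) : ℝ := heightMomentZ n 2 - (heightMomentZ n 1) ^ 2

/-- Apéry's constant `ζ(3) = Σ_{k≥1} k^{−3}`. -/
noncomputable def zeta3 : ℝ := ∑' k : ℕ, 1 / ((k : ℝ) + 1) ^ 3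


section
open Real

/-- number of confined walks ending at `x`, as a real number -/
noncomputable def cntW (h : ℕ) (n : ℕ) (x : ℤ) : ℝ :=
  Nat.card {ε : Fin n → Bool //
    (∀ k ≤ n, 0 ≤ walkSum n ε k ∧ walkSum n ε k ≤ (h : ℤ)) ∧ walkSum n ε n = x}

open Classical in
lemma cntW_eq_sum (h n : ℕ) (x : ℤ) : cntW h n x = ∑ ε : Fin n → Bool,
    if ((∀ k ≤ n, 0 ≤ walkSum n ε k ∧ walkSum n ε k ≤ (h : ℤ)) ∧ walkSum n ε n = x)
      then (1 : ℝ) else 0 := by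
  unfold cntW
  rw [Nat.card_eq_fintype_card, Fintype.card_subtype, Finset.sum_boole]

lemma walkSum_snoc_le (n : ℕ) (ε : Fin n → Bool) (b : Bool) (k : ℕ) (hk : k ≤ n) :
    walkSum (n + 1) (Fin.snoc (α := fun _ => Bool) ε b) k = walkSum n ε k := by
  unfold walkSum
  rw [Fin.sum_univ_castSucc]
  simp [not_lt.mpr hk]

lemma walkSum_snoc_last (n : ℕ) (ε : Fin n → Bool) (b : Bool) :
    walkSum (n + 1) (Fin.snoc (α := fun _ => Bool) ε b) (n + 1)
      = walkSum n ε n + (if b then 1 else -1) := by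
  unfold walkSum
  rw [Fin.sum_univ_castSucc]
  simp only [Fin.snoc_castSucc, Fin.snoc_last, Fin.val_castSucc, Fin.val_last, Nat.lt_succ_self,
    if_true, Fin.is_lt]
  congr 1
  apply Finset.sum_congr rfl
  intro i _
  rw [if_pos (by omega)]

lemma cntW_succ_in (h n : ℕ) (x : ℤ) (hx0 : 0 ≤ x) (hxh : x ≤ h) :
    cntW h (n + 1) x = cntW h n (x - 1) + cntW h n (x + 1) := by
  classical
  simp only [cntW_eq_sum]
  rw [← Fintype.sum_equiv (Fin.snocEquiv (fun _ : Fin (n + 1) => Bool))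
    (fun p => if ((∀ k ≤ n + 1, 0 ≤ walkSum (n + 1) (Fin.snoc (α := fun _ => Bool) p.2 p.1) k
      ∧ walkSum (n + 1) (Fin.snoc (α := fun _ => Bool) p.2 p.1) k ≤ (h : ℤ))
      ∧ walkSum (n + 1) (Fin.snoc (α := fun _ => Bool) p.2 p.1) (n + 1) = x)
      then (1 : ℝ) else 0) _ (fun p => by rfl)]
  rw [Fintype.sum_prod_type]
  rw [Fintype.sum_bool]
  have key : ∀ (b : Bool) (ε : Fin n → Bool),
      ((∀ k ≤ n + 1, 0 ≤ walkSum (n + 1) (Fin.snoc (α := fun _ => Bool) ε b) k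
      ∧ walkSum (n + 1) (Fin.snoc (α := fun _ => Bool) ε b) k ≤ (h : ℤ))
      ∧ walkSum (n + 1) (Fin.snoc (α := fun _ => Bool) ε b) (n + 1) = x) ↔
      ((∀ k ≤ n, 0 ≤ walkSum n ε k ∧ walkSum n ε k ≤ (h : ℤ)) ∧
        walkSum n ε n = x - (if b then 1 else -1)) := by
    intro b ε
    constructor
    · rintro ⟨h1, h2⟩
      refine ⟨fun k hk => ?_, ?_⟩
      · have := h1 k (by omega)
        rwa [walkSum_snoc_le n ε b k hk] at this
      · rw [walkSum_snoc_last] at h2; linarith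
    · rintro ⟨h1, h2⟩
      have h3 : walkSum (n + 1) (Fin.snoc (α := fun _ => Bool) ε b) (n + 1) = x := by
        rw [walkSum_snoc_last, h2]; ring
      refine ⟨fun k hk => ?_, h3⟩
      rcases Nat.lt_or_ge k (n + 1) with hlt | hge
      · rw [walkSum_snoc_le n ε b k (by omega)]; exact h1 k (by omega)
      · have : k = n + 1 := by omega
        subst this
        rw [h3]; exact ⟨hx0, hxh⟩
  congr 1
  · apply Finset.sum_congr rfl
    intro ε _
    simp only [key true ε]; simp
  · apply Finset.sum_congr rfl
    intro ε _
    simp only [key false ε]; simp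

lemma cntW_out (h n : ℕ) (x : ℤ) (hx : x < 0 ∨ (h : ℤ) < x) : cntW h n x = 0 := by
  classical
  rw [cntW_eq_sum]
  apply Finset.sum_eq_zero
  intro ε _
  rw [if_neg]
  rintro ⟨h1, h2⟩
  have := h1 n le_rfl
  omega

lemma cntW_zero (h : ℕ) (x : ℤ) : cntW h 0 x = if x = 0 then 1 else 0 := by
  classical
  rw [cntW_eq_sum]
  have : ∀ (ε : Fin 0 → Bool) (k : ℕ), walkSum 0 ε k = 0 := by
    intro ε k; simp [walkSum]
  simp only [this]
  by_cases hx : x = 0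
  · simp [hx]
  · simp [hx, Ne.symm hx]

/-- sum of cosines over a full set of angles -/
lemma sum_cos_angles (H : ℕ) (hH : 0 < H) (m : ℕ) (hm0 : 0 < m) (hm : m < 2 * H) :
    ∑ j ∈ Finset.range H, cos (j * (m * π / H)) = if Even m then 0 else 1 := by
  have hHr : (0 : ℝ) < H := by exact_mod_cast hH
  set a : ℝ := m * π / H with ha
  have hs : sin (a / 2) ≠ 0 := by
    apply ne_of_gt
    apply sin_pos_of_pos_of_lt_pi
    · have : (0 : ℝ) < m := by exact_mod_cast hm0
      positivity
    · rw [ha, div_div, div_lt_iff₀ (by positivity)]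
      have : (m : ℝ) < 2 * H := by exact_mod_cast hm
      nlinarith [pi_pos]
  have tel : ∀ K : ℕ, 2 * sin (a / 2) * ∑ j ∈ Finset.range K, cos (j * a)
      = sin ((K - 1 / 2) * a) + sin (a / 2) := by
    intro K
    induction K with
    | zero => simp; rw [show (2⁻¹ * a) = (a / 2) by ring]; ring
    | succ K ih =>
      rw [Finset.sum_range_succ, mul_add, ih]
      have e1 : ((K + 1 : ℕ) - 1 / 2 : ℝ) * a = K * a + a / 2 := by push_cast; ring
      have e2 : ((K : ℝ) - 1 / 2) * a = K * a - a / 2 := by ring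
      rw [e1, e2, sin_add, sin_sub]; ring
  have h1 := tel H
  have e3 : ((H : ℝ) - 1 / 2) * a = m * π - a / 2 := by rw [ha]; field_simp
  rw [e3, sin_sub, sin_nat_mul_pi, cos_nat_mul_pi] at h1
  have h2 : 2 * sin (a / 2) * (∑ j ∈ Finset.range H, cos (j * a)
      - if Even m then 0 else 1) = 0 := by
    rw [mul_sub, h1]
    split_ifs with he
    · rw [he.neg_one_pow]; ring
    · rw [(Nat.not_even_iff_odd.mp he).neg_one_pow]; ring
  have h3 := (mul_eq_zero.mp h2).resolve_left (by simpa using hs)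
  linarith

lemma cntW_formula (h n : ℕ) (x : ℤ) (hx1 : -1 ≤ x) (hx2 : x ≤ h + 1) :
    cntW h n x = (2 / (h + 2 : ℝ)) * ∑ j ∈ Finset.range (h + 2),
      (2 * cos (j * π / (h + 2))) ^ n * sin (j * π / (h + 2)) *
        sin (j * π / (h + 2) * (x + 1)) := by
  have hp : (0 : ℝ) < h + 2 := by positivity
  induction n generalizing x with
  | zero =>
    rw [cntW_zero]
    simp only [pow_zero, one_mul]
    have hxx : ∃ y : ℕ, x = (y : ℤ) - 1 := ⟨(x + 1).toNat, by omega⟩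
    obtain ⟨y, rfl⟩ := hxx
    have hprod : ∀ j : ℕ, sin (j * π / (h + 2)) * sin (j * π / (h + 2) * ((((y : ℤ) - 1 : ℤ) : ℝ) + 1))
       = (cos (j * ((y : ℝ) - 1) * π / (h + 2)) - cos (j * (((y + 1 : ℕ) : ℝ) * π / ((h + 2 : ℕ) : ℝ)))) / 2 := by
      intro j
      push_cast
      have e1 : (j : ℝ) * ((y : ℝ) - 1) * π / (h + 2) = j * π / (h + 2) * (y - 1 + 1) - j * π / (h + 2) := by
        ring
      have e2 : (j : ℝ) * (((y : ℝ) + 1) * π / (h + 2)) = j * π / (h + 2) * (y - 1 + 1) + j * π / (h + 2) := by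
        ring
      rw [e1, e2, cos_sub, cos_add]; ring
    simp only [hprod]
    rw [← Finset.sum_div, Finset.sum_sub_distrib]
    rcases Nat.eq_zero_or_pos y with hy | hy
    · subst hy
      have : ∀ j : ℕ, cos (j * ((0 : ℕ) - 1 : ℝ) * π / (h + 2)) = cos (j * (((0 + 1 : ℕ) : ℝ) * π / ((h + 2 : ℕ) : ℝ))) := by
        intro j
        rw [← cos_neg]; congr 1; push_cast; ring
      simp only [this]
      simp
    · rw [sum_cos_angles (h + 2) (by omega) (y + 1) (by omega) (by omega)]
      rcases Nat.eq_or_lt_of_le hy with hy1 | hy1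
      · subst hy1
        simp
        field_simp
      · have : ∀ j : ℕ, cos (j * ((y : ℝ) - 1) * π / (h + 2)) = cos (j * (((y - 1 : ℕ) : ℝ) * π / ((h + 2 : ℕ) : ℝ))) := by
          intro j
          congr 1; push_cast [Nat.cast_sub hy]; ring
        simp only [this]
        rw [sum_cos_angles (h + 2) (by omega) (y - 1) (by omega) (by omega)]
        rw [if_neg (by omega)]
        have : (Even (y - 1)) ↔ Even (y + 1) := by
          rw [Nat.even_sub hy, Nat.even_add]
        simp [this]
  | succ n ih =>
    by_cases hin : 0 ≤ x ∧ x ≤ h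
    · rw [cntW_succ_in h n x hin.1 hin.2, ih (x - 1) (by omega) (by omega),
        ih (x + 1) (by omega) (by omega), ← mul_add, ← Finset.sum_add_distrib]
      congr 1
      apply Finset.sum_congr rfl
      intro j _
      push_cast
      have e1 : (j : ℝ) * π / (h + 2) * (x - 1 + 1) = j * π / (h + 2) * (x + 1) - j * π / (h + 2) := by ring
      have e2 : (j : ℝ) * π / (h + 2) * (x + 1 + 1) = j * π / (h + 2) * (x + 1) + j * π / (h + 2) := by ring
      rw [e1, e2, sin_add, sin_sub]; ring
    · rw [cntW_out h (n + 1) x (by omega)]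
      symm
      apply mul_eq_zero_of_right
      apply Finset.sum_eq_zero
      intro j _
      apply mul_eq_zero_of_right
      have : x = -1 ∨ x = h + 1 := by omega
      rcases this with rfl | rfl
      · simp
      · have : (j : ℝ) * π / (h + 2) * (((h + 1 : ℤ) : ℝ) + 1) = j * π := by
          push_cast; field_simp; ring
        rw [this, sin_nat_mul_pi]

lemma W_formula (n h : ℕ) : (W n h : ℝ) = (2 / (h + 2 : ℝ)) * ∑ j ∈ Finset.range (h + 2),
      (-1) ^ (j + 1) * (2 * cos (j * π / (h + 2))) ^ n * sin (j * π / (h + 2)) ^ 2 := by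
  have hp : (0 : ℝ) < h + 2 := by positivity
  have h0 : (W n h : ℝ) = cntW h n (h : ℤ) := rfl
  rw [h0, cntW_formula h n h (by omega) (by omega)]
  congr 1
  apply Finset.sum_congr rfl
  intro j _
  have : (j : ℝ) * π / (h + 2) * (((h : ℤ) : ℝ) + 1) = j * π - j * π / (h + 2) := by
    push_cast; field_simp; ring
  rw [this, sin_sub, sin_nat_mul_pi, cos_nat_mul_pi]
  ring

lemma walkSum_le (n : ℕ) (ε : Fin n → Bool) (k : ℕ) : walkSum n ε k ≤ n := by
  unfold walkSum
  calc _ ≤ ∑ i : Fin n, (1 : ℤ) := by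
        apply Finset.sum_le_sum; intro i _; split_ifs <;> norm_num
    _ = n := by simp

lemma W_eq_zero (n h : ℕ) (hn : n < h) : W n h = 0 := by
  unfold W
  rw [Nat.card_eq_zero]
  left
  constructor
  rintro ⟨ε, h1, h2⟩
  have := walkSum_le n ε n
  omega

end

section
open Real

lemma W_reflect_term (n H j : ℕ) (hj : j ≤ H) (hH : 0 < H) :
    (-1 : ℝ) ^ ((H - j) + 1) * cos ((H - j : ℕ) * π / H) ^ n * sin ((H - j : ℕ) * π / H) ^ 2
      = (-1) ^ (H + n) * ((-1) ^ (j + 1) * cos (j * π / H) ^ n * sin (j * π / H) ^ 2) := by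
  have hHr : (H : ℝ) ≠ 0 := by positivity
  have e : ((H - j : ℕ) : ℝ) * π / H = π - j * π / H := by
    rw [Nat.cast_sub hj]; field_simp
  rw [e, cos_pi_sub, sin_pi_sub, neg_pow]
  have e2 : (-1 : ℝ) ^ (H - j + 1) = (-1) ^ H * (-1) ^ (j + 1) := by
    have : (-1 : ℝ) ^ H = (-1) ^ (H - j) * (-1) ^ j := by
      rw [← pow_add]; congr 1; omega
    rw [this, pow_succ, pow_succ]
    have : ((-1 : ℝ) ^ j) * (-1) ^ j = 1 := by
      rw [← mul_pow]; norm_num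
    linear_combination ((-1 : ℝ) ^ (H - j)) * this
  rw [e2, pow_add]
  ring

lemma W_fold_aux (n H : ℕ) (hH : 0 < H) (f : ℕ → ℝ) (σ : ℝ) (f0 : f 0 = 0)
    (hf : ∀ j, j ≤ H → f (H - j) = σ * f j) (hmid : ∀ j, 2 * j = H → f j = 0) :
    ∑ j ∈ Finset.range H, f j
      = (1 + σ) * ∑ j ∈ Finset.range H, if (0 < j ∧ 2 * j < H) then f j else 0 := by
  have h1 : ∑ j ∈ Finset.range H, f j =
      ∑ j ∈ Finset.range H, (if (0 < j ∧ 2 * j < H) then f j else 0)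
      + ∑ j ∈ Finset.range H, (if (H < 2 * j) then f j else 0) := by
    rw [← Finset.sum_add_distrib]
    apply Finset.sum_congr rfl
    intro j _
    rcases Nat.eq_zero_or_pos j with h0 | h0
    · subst h0; simp [f0]
    · rcases lt_trichotomy (2 * j) H with h | h | h
      · rw [if_pos ⟨h0, h⟩, if_neg (by omega), add_zero]
      · rw [hmid j h]; simp
      · rw [if_neg (by omega), if_pos h, zero_add]
  have h2 : ∑ j ∈ Finset.range H, (if (H < 2 * j) then f j else 0)
     = σ * ∑ j ∈ Finset.range H, if (0 < j ∧ 2 * j < H) then f j else 0 := by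
    rw [Finset.mul_sum]
    have h3 : ∑ j ∈ Finset.range (H + 1), (if (0 < j ∧ 2 * j < H) then σ * f j else 0)
      = ∑ j ∈ Finset.range H, σ * (if (0 < j ∧ 2 * j < H) then f j else 0) := by
      rw [Finset.sum_range_succ, if_neg (by omega), add_zero]
      apply Finset.sum_congr rfl; intro j _; split_ifs <;> simp
    have fH : f H = 0 := by
      have := hf 0 (by omega); rw [f0] at this; simpa using this
    have h5 : ∑ j ∈ Finset.range (H + 1), (if (H < 2 * j) then f j else 0) =
        ∑ j ∈ Finset.range H, (if (H < 2 * j) then f j else 0) := by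
      rw [Finset.sum_range_succ, if_pos (by omega), fH, add_zero]
    rw [← h3, ← h5, ← Finset.sum_range_reflect]
    apply Finset.sum_congr rfl
    intro j hj
    have hj' := Finset.mem_range.mp hj
    have e : H + 1 - 1 - j = H - j := by omega
    rw [e]
    rcases Nat.eq_zero_or_pos j with h0 | h0
    · subst h0; simp [fH]
    · by_cases hc : 2 * j < H
      · rw [if_pos (by omega), if_pos ⟨h0, hc⟩, hf j (by omega)]
      · rw [if_neg (by omega), if_neg (by omega)]
  rw [h1, h2]; ring

lemma W_fold (n h : ℕ) (hn : 1 ≤ n) : (W n h : ℝ) = 2 ^ n * (2 / (h + 2 : ℝ)) *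
    ((1 + (-1) ^ (h + 2 + n)) * ∑ j ∈ Finset.range (h + 2), if (0 < j ∧ 2 * j < h + 2) then
      (-1) ^ (j + 1) * cos (j * π / (h + 2)) ^ n * sin (j * π / (h + 2)) ^ 2 else 0) := by
  rw [W_formula, ← W_fold_aux n (h + 2) (by omega)
    (fun j => (-1) ^ (j + 1) * cos (j * π / (h + 2)) ^ n * sin (j * π / (h + 2)) ^ 2)]
  · rw [mul_comm (2 ^ n : ℝ), mul_assoc, Finset.mul_sum (a := (2 : ℝ) ^ n)]
    congr 1
    apply Finset.sum_congr rfl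
    intro j _
    rw [mul_pow]; ring
  · simp
  · intro j hj
    have := W_reflect_term n (h + 2) j hj (by omega)
    push_cast at this ⊢
    exact this
  · intro j hj
    have : (j : ℝ) * π / (h + 2) = π / 2 := by
      have : (2 * j : ℝ) = h + 2 := by exact_mod_cast hj
      rw [← this]
      have : (j : ℝ) ≠ 0 := by
        have : 0 < j := by omega
        positivity
      field_simp
    simp only [this, cos_pi_div_two]
    rw [zero_pow (by omega)]; simp

end

section
open Real MeasureTheory Filter Topology

/-- periodised error of the step-2 lattice sum -/
noncomputable def perr (F : ℝ → ℝ) (t : ℝ) : ℝ :=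
  (∑' m : ℤ, F (t + 2 * m)) - (1 / 2) * ∫ x, F x

/-- continuous with inverse-quadratic decay -/
def NiceF (F : ℝ → ℝ) : Prop := Continuous F ∧ ∃ K : ℝ, ∀ x, |F x| ≤ K * (1 + x ^ 2)⁻¹

lemma NiceF.integrable {F : ℝ → ℝ} (hF : NiceF F) : Integrable F := by
  obtain ⟨hc, K, hK⟩ := hF
  refine Integrable.mono' (integrable_inv_one_add_sq.const_mul K) hc.aestronglyMeasurable ?_
  exact Eventually.of_forall (fun x => by simpa using hK x)

lemma sq_shift_bound (t : ℝ) (m : ℤ) :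
    (1 + (t + 2 * m) ^ 2)⁻¹ ≤ (1 + t ^ 2) * (1 + (m : ℝ) ^ 2)⁻¹ := by
  rw [← div_eq_mul_inv, inv_eq_one_div, div_le_div_iff₀ (by positivity) (by positivity)]
  nlinarith [sq_nonneg ((m : ℝ) + t), sq_nonneg (t * (t + 2 * m)), sq_nonneg (m : ℝ), sq_nonneg t]

lemma summable_inv_one_add_sq_int : Summable (fun m : ℤ => (1 + (m : ℝ) ^ 2)⁻¹) := by
  have h : Summable (fun m : ℤ => 1 / (m : ℝ) ^ 2) :=
    Real.summable_one_div_int_pow.mpr (by norm_num)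
  refine Summable.of_norm_bounded_eventually (g := fun m : ℤ => 1 / (m : ℝ) ^ 2) h ?_
  rw [Filter.eventually_cofinite]
  refine Set.Finite.subset (Set.finite_singleton (0 : ℤ)) ?_
  intro m hm
  by_contra hne
  apply hm
  have hm0 : (m : ℝ) ≠ 0 := by exact_mod_cast hne
  rw [Real.norm_of_nonneg (by positivity), inv_eq_one_div]
  apply one_div_le_one_div_of_le (by positivity)
  linarith

lemma NiceF.bound {F : ℝ → ℝ} (hF : NiceF F) : ∃ K : ℝ, 0 ≤ K ∧ ∀ (t : ℝ) (m : ℤ),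
    ‖F (t + 2 * m)‖ ≤ K * ((1 + t ^ 2) * (1 + (m : ℝ) ^ 2)⁻¹) := by
  obtain ⟨hc, K, hK⟩ := hF
  have K0 : 0 ≤ K := by
    have := (abs_nonneg _).trans (hK 0); simpa using this
  refine ⟨K, K0, fun t m => ?_⟩
  rw [Real.norm_eq_abs]
  exact (hK _).trans (mul_le_mul_of_nonneg_left (sq_shift_bound t m) K0)

lemma NiceF.summable {F : ℝ → ℝ} (hF : NiceF F) (t : ℝ) :
    Summable (fun m : ℤ => F (t + 2 * m)) := by
  obtain ⟨K, K0, hK⟩ := hF.bound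
  exact Summable.of_norm_bounded ((summable_inv_one_add_sq_int.mul_left _).mul_left K) (hK t)

lemma NiceF.tendsto {F : ℝ → ℝ} (hF : NiceF F) (l : Filter ℝ) (hl : Tendsto (fun x : ℝ => x ^ 2) l atTop) :
    Tendsto F l (𝓝 0) := by
  obtain ⟨hc, K, hK⟩ := hF
  refine squeeze_zero_norm (a := fun x => K * (1 + x ^ 2)⁻¹) (fun x => by simpa using hK x) ?_
  have : Tendsto (fun x : ℝ => (1 + x ^ 2)⁻¹) l (𝓝 0) :=
    tendsto_inv_atTop_zero.comp (tendsto_atTop_add_const_left _ _ hl)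
  simpa using this.const_mul K

lemma NiceF.integral_deriv {F F' : ℝ → ℝ} (hF : NiceF F) (hF' : NiceF F')
    (hd : ∀ x, HasDerivAt F (F' x) x) : ∫ x, F' x = 0 := by
  have h1 : Tendsto (fun x : ℝ => x ^ 2) atTop atTop := tendsto_pow_atTop (by norm_num)
  have h2 : Tendsto (fun x : ℝ => x ^ 2) atBot atTop := by
    have := h1.comp tendsto_neg_atBot_atTop
    refine this.congr (fun x => by simp)
  have := integral_of_hasDerivAt_of_tendsto hd hF'.integrable (hF.tendsto _ h2) (hF.tendsto _ h1)
  simpa using this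

lemma NiceF.integral_period {F : ℝ → ℝ} (hF : NiceF F) (t : ℝ) :
    ∫ s in t..(t + 2), (∑' m : ℤ, F (s + 2 * m)) = ∫ x, F x := by
  obtain ⟨K, K0, hK⟩ := hF.bound
  have h1 : HasSum (fun m : ℤ => ∫ s in t..(t + 2), F (s + 2 * m))
      (∫ s in t..(t + 2), (∑' m : ℤ, F (s + 2 * m))) := by
    refine intervalIntegral.hasSum_integral_of_dominated_convergence
      (fun m s => K * ((1 + s ^ 2) * (1 + (m : ℝ) ^ 2)⁻¹)) ?_ ?_ ?_ ?_ ?_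
    · intro m
      exact (hF.1.comp (by fun_prop)).aestronglyMeasurable
    · intro m; exact Eventually.of_forall (fun s _ => hK s m)
    · exact Eventually.of_forall (fun s _ => (summable_inv_one_add_sq_int.mul_left _).mul_left K)
    · have : (fun s : ℝ => ∑' m : ℤ, K * ((1 + s ^ 2) * (1 + (m : ℝ) ^ 2)⁻¹))
        = fun s : ℝ => K * ((1 + s ^ 2) * ∑' m : ℤ, (1 + (m : ℝ) ^ 2)⁻¹) := by
        ext s; rw [tsum_mul_left, tsum_mul_left]
      rw [this]
      exact Continuous.intervalIntegrable (by fun_prop) _ _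
    · exact Eventually.of_forall (fun s _ => (hF.summable s).hasSum)
  have h2 : HasSum (fun m : ℤ => ∫ x in (t / 2 + m)..(t / 2 + m + 1), F (2 * x)) (∫ x, F (2 * x)) := by
    refine Integrable.hasSum_intervalIntegral ?_ (t / 2)
    exact hF.integrable.comp_mul_left' (by norm_num)
  have h3 : ∀ m : ℤ, ∫ s in t..(t + 2), F (s + 2 * m)
      = 2 * ∫ x in (t / 2 + m)..(t / 2 + m + 1), F (2 * x) := by
    intro m
    rw [intervalIntegral.integral_comp_mul_left (fun x => F x) (by norm_num : (2 : ℝ) ≠ 0),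
      intervalIntegral.integral_comp_add_right (fun x => F x)]
    simp only [smul_eq_mul]
    rw [← mul_assoc]
    norm_num
    congr 1 <;> ring
  have h4 := h2.mul_left 2
  simp only [← h3] at h4
  rw [h1.unique h4, Measure.integral_comp_mul_left (fun x => F x)]
  norm_num
  rw [← mul_assoc]; norm_num

lemma NiceF.hasDerivAt_perr {F F' : ℝ → ℝ} (hF : NiceF F) (hF' : NiceF F')
    (hd : ∀ x, HasDerivAt F (F' x) x) (t : ℝ) : HasDerivAt (perr F) (perr F' t) t := by
  obtain ⟨K, K0, hK⟩ := hF'.bound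
  have hmem : t ∈ Metric.ball t 1 := Metric.mem_ball_self one_pos
  have key : HasDerivAt (fun s => ∑' m : ℤ, F (s + 2 * m)) (∑' m : ℤ, F' (t + 2 * m)) t := by
    refine hasDerivAt_tsum_of_isPreconnected (t := Metric.ball t 1)
      (g := fun (m : ℤ) (s : ℝ) => F (s + 2 * m)) (g' := fun (m : ℤ) (s : ℝ) => F' (s + 2 * m))
      (u := fun m : ℤ => K * ((1 + (|t| + 1) ^ 2) * (1 + (m : ℝ) ^ 2)⁻¹)) (y₀ := t)
      ((summable_inv_one_add_sq_int.mul_left _).mul_left K) Metric.isOpen_ball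
      (convex_ball t 1).isPreconnected ?_ ?_ hmem (hF.summable t) hmem
    · intro m y hy
      exact (hd (y + 2 * m)).comp_add_const y (2 * (m : ℝ))
    · intro m y hy
      refine (hK y m).trans ?_
      have : |y| ≤ |t| + 1 := by
        have h := Metric.mem_ball.mp hy
        rw [Real.dist_eq] at h
        have := abs_sub_abs_le_abs_sub y t
        linarith
      have : y ^ 2 ≤ (|t| + 1) ^ 2 := by
        rw [← sq_abs y]; gcongr
      gcongr
  have e : perr F' t = ∑' m : ℤ, F' (t + 2 * m) := by
    unfold perr
    rw [hF.integral_deriv hF' hd, mul_zero, sub_zero]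
  rw [e]
  exact key.sub_const _

lemma NiceF.perr_step {F F' : ℝ → ℝ} (hF : NiceF F) (hF' : NiceF F')
    (hd : ∀ x, HasDerivAt F (F' x) x) (B : ℝ) (hB : ∀ t, |perr F' t| ≤ B) (t : ℝ) :
    |perr F t| ≤ 2 * B := by
  have hder := hF.hasDerivAt_perr hF' hd
  have hcont : Continuous (perr F) := continuous_iff_continuousAt.mpr (fun x => (hder x).continuousAt)
  have hlip : ∀ s, ‖perr F t - perr F s‖ ≤ B * ‖t - s‖ := by
    intro s
    exact Convex.norm_image_sub_le_of_norm_hasDerivWithin_le (f := perr F) (f' := perr F') (s := Set.univ)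
      (fun x _ => (hder x).hasDerivWithinAt) (fun x _ => hB x) convex_univ trivial trivial
  have hcs : Continuous (fun s => ∑' m : ℤ, F (s + 2 * m)) := by
    have : (fun s => ∑' m : ℤ, F (s + 2 * m)) = fun s => perr F s + (1 / 2) * ∫ x, F x := by
      ext s; unfold perr; ring
    rw [this]; fun_prop
  have hz : ∫ s in t..(t + 2), perr F s = 0 := by
    unfold perr
    rw [intervalIntegral.integral_sub (hcs.intervalIntegrable _ _) (by simp), hF.integral_period t]
    simp
  have h2 : ∫ s in t..(t + 2), (perr F t - perr F s) = 2 * perr F t := by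
    rw [intervalIntegral.integral_sub (by simp) (hcont.intervalIntegrable _ _), hz]
    simp
  have h3 : ‖∫ s in t..(t + 2), (perr F t - perr F s)‖ ≤ (B * 2) * |t + 2 - t| := by
    apply intervalIntegral.norm_integral_le_of_norm_le_const
    intro s hs
    rw [Set.uIoc_of_le (by linarith)] at hs
    refine (hlip s).trans ?_
    have hB0 : 0 ≤ B := (abs_nonneg _).trans (hB 0)
    apply mul_le_mul_of_nonneg_left _ hB0
    rw [Real.norm_eq_abs, abs_le]; constructor <;> linarith [hs.1, hs.2]
  rw [h2] at h3
  have : |t + 2 - t| = 2 := by rw [add_sub_cancel_left]; norm_num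
  rw [this, norm_mul, Real.norm_eq_abs, Real.norm_eq_abs] at h3
  norm_num at h3
  linarith

lemma perr_add {F G : ℝ → ℝ} (hF : NiceF F) (hG : NiceF G) (t : ℝ) :
    perr (fun x => F x + G x) t = perr F t + perr G t := by
  unfold perr
  rw [integral_add hF.integrable hG.integrable, (hF.summable t).tsum_add (hG.summable t)]
  ring

lemma perr_smul (c : ℝ) (F : ℝ → ℝ) (t : ℝ) :
    perr (fun x => c * F x) t = c * perr F t := by
  unfold perr
  rw [integral_const_mul, tsum_mul_left]
  ring

lemma NiceF.add {F G : ℝ → ℝ} (hF : NiceF F) (hG : NiceF G) : NiceF (fun x => F x + G x) := by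
  obtain ⟨hc, K, hK⟩ := hF
  obtain ⟨hc', K', hK'⟩ := hG
  refine ⟨hc.add hc', K + K', fun x => ?_⟩
  rw [add_mul]
  exact (abs_add_le _ _).trans (add_le_add (hK x) (hK' x))

lemma NiceF.smul {F : ℝ → ℝ} (c : ℝ) (hF : NiceF F) : NiceF (fun x => c * F x) := by
  obtain ⟨hc, K, hK⟩ := hF
  refine ⟨hc.const_mul c |>.congr (fun x => rfl), |c| * K, fun x => ?_⟩
  rw [abs_mul, mul_assoc]
  exact mul_le_mul_of_nonneg_left (hK x) (abs_nonneg _)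

end

section
open Real MeasureTheory Filter Topology

lemma perr_periodic (F : ℝ → ℝ) (t : ℝ) (k : ℤ) : perr F (t + 2 * k) = perr F t := by
  unfold perr
  congr 1
  rw [← (Equiv.addLeft k).tsum_eq (fun m : ℤ => F (t + 2 * m))]
  apply tsum_congr
  intro m
  congr 1
  simp only [Equiv.coe_addLeft]
  push_cast; ring

lemma perr_crude : ∃ C₀ : ℝ, 0 < C₀ ∧ ∀ (F : ℝ → ℝ) (K : ℝ), 0 ≤ K → Continuous F →
    (∀ x, |F x| ≤ K * (1 + x ^ 2)⁻¹) → ∀ t, |perr F t| ≤ C₀ * K := by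
  have hS0 : 0 ≤ ∑' m : ℤ, (1 + (m : ℝ) ^ 2)⁻¹ := tsum_nonneg (fun m => by positivity)
  have hI0 : 0 ≤ ∫ x : ℝ, (1 + x ^ 2)⁻¹ := integral_nonneg (fun x => by positivity)
  refine ⟨5 * (∑' m : ℤ, (1 + (m : ℝ) ^ 2)⁻¹) + (1 / 2) * (∫ x : ℝ, (1 + x ^ 2)⁻¹) + 1, by positivity,
    fun F K hK hc hF t => ?_⟩
  have e : perr F t = perr F (t - 2 * ⌊t / 2⌋) := by
    have := perr_periodic F t (-⌊t / 2⌋)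
    rw [← this]; congr 1; push_cast; ring
  rw [e]
  set u := t - 2 * ⌊t / 2⌋ with hu
  have hu0 : 0 ≤ u := by have := Int.floor_le (t / 2); rw [hu]; linarith
  have hu2 : u ≤ 2 := by have := (Int.lt_floor_add_one (t / 2)).le; rw [hu]; linarith
  have h1 : ‖∑' m : ℤ, F (u + 2 * m)‖ ≤ ∑' m : ℤ, (K * 5) * (1 + (m : ℝ) ^ 2)⁻¹ := by
    apply tsum_of_norm_bounded (summable_inv_one_add_sq_int.mul_left (K * 5)).hasSum
    intro m
    rw [Real.norm_eq_abs]
    refine (hF _).trans ?_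
    rw [mul_assoc]
    apply mul_le_mul_of_nonneg_left _ hK
    refine (sq_shift_bound u m).trans ?_
    gcongr
    nlinarith
  have h2 : ‖∫ x, F x‖ ≤ ∫ x : ℝ, K * (1 + x ^ 2)⁻¹ := by
    apply norm_integral_le_of_norm_le (integrable_inv_one_add_sq.const_mul K)
    exact Eventually.of_forall (fun x => by simpa using hF x)
  rw [tsum_mul_left] at h1
  rw [integral_const_mul] at h2
  unfold perr
  rw [Real.norm_eq_abs] at h1 h2
  refine (abs_sub _ _).trans ?_
  rw [abs_mul, abs_of_pos (by norm_num : (0 : ℝ) < 1 / 2)]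
  nlinarith

/-- the basic family of functions -/
noncomputable def TT (p c b l : ℕ) (z : ℤ) (J δ : ℝ) (x : ℝ) : ℝ :=
  if 2 * J < x then
    cos (J * π / x) ^ p * sin (J * π / x) ^ c * ((J * π) ^ b * δ ^ l * (x ^ z * exp (-(δ * x))))
  else 0

/-- derivative of a member of the family -/
noncomputable def TTd (p c b l : ℕ) (z : ℤ) (J δ : ℝ) (x : ℝ) : ℝ :=
  (p : ℝ) * TT (p - 1) (c + 1) (b + 1) l (z - 2) J δ x
    + ((-(c : ℝ)) * TT (p + 1) (c - 1) (b + 1) l (z - 2) J δ x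
    + ((z : ℝ) * TT p c b l (z - 1) J δ x + (-1) * TT p c b (l + 1) z J δ x))

lemma hasDerivAt_raw (p c b l : ℕ) (z : ℤ) (J δ x : ℝ) (hx : 0 < x) :
    HasDerivAt (fun x => cos (J * π / x) ^ p * sin (J * π / x) ^ c *
      ((J * π) ^ b * δ ^ l * (x ^ z * exp (-(δ * x)))))
      ((p : ℝ) * (cos (J * π / x) ^ (p - 1) * sin (J * π / x) ^ (c + 1) *
      ((J * π) ^ (b + 1) * δ ^ l * (x ^ (z - 2) * exp (-(δ * x))))) +
      ((-(c : ℝ)) * (cos (J * π / x) ^ (p + 1) * sin (J * π / x) ^ (c - 1) *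
      ((J * π) ^ (b + 1) * δ ^ l * (x ^ (z - 2) * exp (-(δ * x))))) +
      ((z : ℝ) * (cos (J * π / x) ^ p * sin (J * π / x) ^ c *
      ((J * π) ^ b * δ ^ l * (x ^ (z - 1) * exp (-(δ * x))))) +
      (-1) * (cos (J * π / x) ^ p * sin (J * π / x) ^ c *
      ((J * π) ^ b * δ ^ (l + 1) * (x ^ z * exp (-(δ * x)))))))) x := by
  have hθ : HasDerivAt (fun x : ℝ => J * π / x) (-(J * π) / x ^ 2) x := by
    have := (hasDerivAt_inv hx.ne').const_mul (J * π)
    refine (this.congr_deriv ?_)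
    field_simp
  have hc := (hθ.cos).pow p
  have hs := (hθ.sin).pow c
  have hz := hasDerivAt_zpow z x (Or.inl hx.ne')
  have he : HasDerivAt (fun x : ℝ => exp (-(δ * x))) (exp (-(δ * x)) * (-(δ * 1))) x :=
    (((hasDerivAt_id x).const_mul δ).neg).exp
  have := (hc.mul hs).mul ((hz.mul he).const_mul ((J * π) ^ b * δ ^ l))
  refine this.congr_deriv ?_
  have e1 : x ^ (z - 2) = x ^ z / x ^ 2 := by
    rw [zpow_sub₀ hx.ne']; norm_cast
  have e2 : x ^ (z - 1) = x ^ z / x := by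
    rw [zpow_sub₀ hx.ne', zpow_one]
  simp only [Pi.mul_apply, Pi.pow_apply]
  rw [e1, e2]
  field_simp
  ring

lemma hasDerivAt_TT (p c b l : ℕ) (z : ℤ) (J δ x : ℝ) (hJ : 0 < J) (hp : 2 ≤ p) :
    HasDerivAt (TT p c b l z J δ) (TTd p c b l z J δ x) x := by
  rcases lt_trichotomy x (2 * J) with h | h | h
  · have e : TTd p c b l z J δ x = 0 := by
      unfold TTd TT; simp [not_lt.mpr h.le]
    rw [e]
    refine (hasDerivAt_const x (0 : ℝ)).congr_of_eventuallyEq ?_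
    filter_upwards [Iio_mem_nhds h] with y hy
    unfold TT; rw [if_neg (not_lt.mpr (le_of_lt hy))]
  · have e : TTd p c b l z J δ x = 0 := by
      unfold TTd TT; simp [h]
    rw [e]
    have hx : 0 < x := by linarith
    have hcz : cos (J * π / x) = 0 := by
      rw [h, show J * π / (2 * J) = π / 2 by field_simp, cos_pi_div_two]
    have hraw := hasDerivAt_raw p c b l z J δ x hx
    rw [hcz] at hraw
    rw [zero_pow (by omega : p - 1 ≠ 0), zero_pow (by omega : p ≠ 0), zero_pow (by omega : p + 1 ≠ 0)] at hraw
    simp only [zero_mul, mul_zero, add_zero] at hraw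
    rw [← hasDerivWithinAt_univ, ← Set.Iic_union_Ici (a := x)]
    refine HasDerivWithinAt.union ?_ ?_
    · refine (hasDerivWithinAt_const x (Set.Iic x) (0 : ℝ)).congr ?_ ?_
      · intro y hy; unfold TT; rw [if_neg (not_lt.mpr (by rw [← h]; exact hy))]
      · unfold TT; rw [if_neg (not_lt.mpr (by rw [← h]))]
    · refine hraw.hasDerivWithinAt.congr ?_ ?_
      · intro y hy
        rcases eq_or_lt_of_le (show x ≤ y from hy) with h1 | h1
        · subst h1
          unfold TT; rw [if_neg (not_lt.mpr (by rw [← h])), hcz, zero_pow (by omega)]; simp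
        · unfold TT; rw [if_pos (by linarith)]
      · unfold TT; rw [if_neg (not_lt.mpr (by rw [← h])), hcz, zero_pow (by omega)]; simp
  · have hx : 0 < x := by linarith
    have h0 := hasDerivAt_raw p c b l z J δ x hx
    have hev : TT p c b l z J δ =ᶠ[𝓝 x] (fun x => cos (J * π / x) ^ p * sin (J * π / x) ^ c *
        ((J * π) ^ b * δ ^ l * (x ^ z * exp (-(δ * x))))) := by
      filter_upwards [Ioi_mem_nhds h] with y hy
      unfold TT
      exact if_pos hy
    refine (h0.congr_of_eventuallyEq hev).congr_deriv ?_
    unfold TTd TT; simp only [if_pos h]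

lemma continuous_TT (p c b l : ℕ) (z : ℤ) (J δ : ℝ) (hJ : 0 < J) (hp : 2 ≤ p) :
    Continuous (TT p c b l z J δ) :=
  continuous_iff_continuousAt.mpr (fun x => (hasDerivAt_TT p c b l z J δ x hJ hp).continuousAt)

lemma pow_mul_exp_neg_le (m : ℕ) (u : ℝ) (hu : 0 ≤ u) : u ^ m * exp (-u) ≤ m.factorial := by
  have h := Real.pow_div_factorial_le_exp u hu m
  rw [exp_neg, ← div_eq_mul_inv, div_le_iff₀ (exp_pos u)]
  rw [div_le_iff₀ (by positivity)] at h
  linarith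

lemma inv_sq_le (x : ℝ) (hx : 1 ≤ x) : (x ^ 2)⁻¹ ≤ 2 * (1 + x ^ 2)⁻¹ := by
  rw [← div_eq_mul_inv, inv_eq_one_div, div_le_div_iff₀ (by positivity) (by positivity)]
  nlinarith

lemma nice_TT (p c b l : ℕ) (z : ℤ) (J δ : ℝ) (hJ : 1 ≤ J) (hδ : 0 < δ) (hp : 2 ≤ p) :
    NiceF (TT p c b l z J δ) := by
  refine ⟨continuous_TT p c b l z J δ (by linarith) hp, ?_⟩
  set k := z.toNat
  refine ⟨(J * π) ^ b * δ ^ l * (((k + 2).factorial / δ ^ (k + 2)) * 2), fun x => ?_⟩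
  unfold TT
  split_ifs with h
  · have hx : 1 ≤ x := by linarith
    have hx0 : 0 < x := by linarith
    rw [abs_mul, abs_mul, abs_pow, abs_pow]
    have h1 : |cos (J * π / x)| ^ p ≤ 1 := pow_le_one₀ (abs_nonneg _) (abs_cos_le_one _)
    have h2 : |sin (J * π / x)| ^ c ≤ 1 := pow_le_one₀ (abs_nonneg _) (abs_sin_le_one _)
    have h3 : |cos (J * π / x)| ^ p * |sin (J * π / x)| ^ c ≤ 1 :=
      mul_le_one₀ h1 (by positivity) h2
    have h4 : x ^ z * exp (-(δ * x)) ≤ ((k + 2).factorial / δ ^ (k + 2)) * 2 * (1 + x ^ 2)⁻¹ := by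
      have a1 : x ^ z ≤ x ^ (k : ℤ) := zpow_le_zpow_right₀ hx (Int.self_le_toNat z)
      rw [zpow_natCast] at a1
      have a2 := pow_mul_exp_neg_le (k + 2) (δ * x) (by positivity)
      have a3 : x ^ k * exp (-(δ * x)) ≤ ((k + 2).factorial / δ ^ (k + 2)) * (x ^ 2)⁻¹ := by
        rw [← div_eq_mul_inv, le_div_iff₀ (by positivity), le_div_iff₀ (by positivity)]
        calc _ = (δ * x) ^ (k + 2) * exp (-(δ * x)) := by ring
          _ ≤ _ := a2
      calc _ ≤ x ^ k * exp (-(δ * x)) := by gcongr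
        _ ≤ _ := a3
        _ ≤ ((k + 2).factorial / δ ^ (k + 2)) * (2 * (1 + x ^ 2)⁻¹) := by
            gcongr; exact inv_sq_le x hx
        _ = _ := by ring
    have h5 : 0 ≤ (J * π) ^ b * δ ^ l * (x ^ z * exp (-(δ * x))) := by positivity
    rw [abs_of_nonneg h5]
    calc _ ≤ 1 * ((J * π) ^ b * δ ^ l * (x ^ z * exp (-(δ * x)))) := by gcongr
      _ ≤ 1 * ((J * π) ^ b * δ ^ l * (((k + 2).factorial / δ ^ (k + 2)) * 2 * (1 + x ^ 2)⁻¹)) := by gcongr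
      _ = _ := by ring
  · rw [abs_zero]; positivity

lemma cos_pow_le (θ : ℝ) (n p : ℕ) (h0 : 0 ≤ θ) (h1 : θ ≤ π / 2) (hp : n ≤ 2 * p) :
    cos θ ^ p ≤ exp (-((√n * θ / π) ^ 2)) := by
  have hc0 : 0 ≤ cos θ := cos_nonneg_of_mem_Icc ⟨by linarith [pi_pos], h1⟩
  have hc : cos θ ≤ exp (-(2 / π ^ 2 * θ ^ 2)) := by
    have := cos_le_one_sub_mul_cos_sq (x := θ) (by rw [abs_of_nonneg h0]; linarith [pi_pos])
    have h2 := Real.add_one_le_exp (-(2 / π ^ 2 * θ ^ 2))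
    linarith
  calc cos θ ^ p ≤ exp (-(2 / π ^ 2 * θ ^ 2)) ^ p := by gcongr
    _ = exp (p * (-(2 / π ^ 2 * θ ^ 2))) := by rw [← exp_nat_mul]
    _ ≤ _ := by
      apply exp_le_exp.mpr
      rw [div_pow, mul_pow, sq_sqrt (by positivity)]
      have : (n : ℝ) ≤ 2 * p := by exact_mod_cast hp
      have h3 : 0 ≤ θ ^ 2 / π ^ 2 := by positivity
      calc (p : ℝ) * (-(2 / π ^ 2 * θ ^ 2)) = - (2 * p * (θ ^ 2 / π ^ 2)) := by ring
        _ ≤ -(n * (θ ^ 2 / π ^ 2)) := by nlinarith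
        _ = _ := by ring

lemma pow_gauss_le (q : ℕ) (w : ℝ) (hw : 0 ≤ w) :
    w ^ q * exp (-((w / π) ^ 2)) ≤ 1 + π ^ (2 * q) * q.factorial := by
  have h1 : w ^ q ≤ 1 + w ^ (2 * q) := by
    have : w ^ (2 * q) = (w ^ q) ^ 2 := by rw [← pow_mul]; ring_nf
    rw [this]; nlinarith [sq_nonneg (w ^ q - 1), sq_nonneg (w ^ q)]
  have h2 := pow_mul_exp_neg_le q ((w / π) ^ 2) (by positivity)
  have h3 : exp (-((w / π) ^ 2)) ≤ 1 := by
    rw [exp_le_one_iff]; have := sq_nonneg (w / π); linarith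
  have h4 : w ^ (2 * q) = π ^ (2 * q) * ((w / π) ^ 2) ^ q := by
    rw [← pow_mul, ← mul_pow]; congr 1; field_simp
  calc _ ≤ (1 + w ^ (2 * q)) * exp (-((w / π) ^ 2)) := by gcongr
    _ = exp (-((w / π) ^ 2)) + π ^ (2 * q) * (((w / π) ^ 2) ^ q * exp (-((w / π) ^ 2))) := by
      rw [h4]; ring
    _ ≤ _ := by gcongr

lemma TT_pointwise (c b l e k : ℕ) (z : ℤ) (he : c + b = 2 * e) (hs : z + b - l = -2 - k) :
    ∃ C : ℝ, 0 < C ∧ ∀ (n p : ℕ) (J δ : ℝ), 1 ≤ n → n ≤ 2 * p → 1 ≤ J → 0 < δ → ∀ x,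
      |TT p c b l z J δ x| ≤ (C * ((n : ℝ) ^ e)⁻¹ * ((J * √n) ^ k)⁻¹) * (1 + x ^ 2)⁻¹ := by
  refine ⟨2 * (l.factorial * ((1 + π ^ (2 * (2 * e + k)) * (2 * e + k).factorial) * (π ^ k)⁻¹)), by positivity, ?_⟩
  intro n p J δ hn hp hJ hδ x
  have hn0 : (0 : ℝ) < n := by exact_mod_cast hn
  unfold TT
  split_ifs with h
  swap
  · rw [abs_zero]; positivity
  have hx : 1 ≤ x := by linarith
  have hx0 : 0 < x := by linarith
  have hJ0 : 0 < J := by linarith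
  set θ := J * π / x with hθ
  have hθ0 : 0 < θ := by positivity
  have hθ1 : θ ≤ π / 2 := by
    rw [hθ, div_le_div_iff₀ hx0 (by norm_num)]; nlinarith [pi_pos]
  have hc0 : 0 ≤ cos θ := cos_nonneg_of_mem_Icc ⟨by linarith [pi_pos], hθ1⟩
  have hs0 : 0 ≤ sin θ := sin_nonneg_of_nonneg_of_le_pi hθ0.le (by linarith [pi_pos])
  have hs1 : sin θ ≤ θ := sin_le hθ0.le
  rw [abs_of_nonneg (by positivity)]
  have hxz : (J * π) ^ b * δ ^ l * (x ^ z * exp (-(δ * x)))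
      = θ ^ b * ((δ * x) ^ l * exp (-(δ * x))) * (x ^ k)⁻¹ * (x ^ 2)⁻¹ := by
    have : x ^ z = x ^ l * (x ^ b)⁻¹ * (x ^ k)⁻¹ * (x ^ 2)⁻¹ := by
      have : z = (l : ℤ) + (-(b : ℤ)) + (-(k : ℤ)) + (-2) := by omega
      rw [this, zpow_add₀ hx0.ne', zpow_add₀ hx0.ne', zpow_add₀ hx0.ne', zpow_neg, zpow_neg, zpow_neg]
      norm_cast
    rw [this, hθ, div_pow, mul_pow δ x]; field_simp
  rw [hxz]
  have hxk : (x ^ k)⁻¹ = (π ^ k)⁻¹ * ((J * √n) ^ k)⁻¹ * (√n * θ) ^ k := by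
    have hsq : √(n : ℝ) ≠ 0 := by positivity
    rw [hθ, ← inv_pow, ← inv_pow, ← inv_pow, ← mul_pow, ← mul_pow]
    congr 1
    field_simp
  have hne : θ ^ (c + b) = ((n : ℝ) ^ e)⁻¹ * (√n * θ) ^ (2 * e) := by
    rw [he, mul_pow, pow_mul, pow_mul, sq_sqrt hn0.le]; field_simp
  have g1 := cos_pow_le θ n p hθ0.le hθ1 hp
  have g2 := pow_gauss_le (2 * e + k) (√n * θ) (by positivity)
  have g3 := pow_mul_exp_neg_le l (δ * x) (by positivity)
  have g4 := inv_sq_le x hx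
  calc cos θ ^ p * sin θ ^ c * (θ ^ b * ((δ * x) ^ l * exp (-(δ * x))) * (x ^ k)⁻¹ * (x ^ 2)⁻¹)
      ≤ exp (-((√n * θ / π) ^ 2)) * θ ^ c * (θ ^ b * l.factorial * (x ^ k)⁻¹ * (2 * (1 + x ^ 2)⁻¹)) := by
        gcongr
    _ = 2 * l.factorial * (θ ^ (c + b) * (exp (-((√n * θ / π) ^ 2)) * (x ^ k)⁻¹)) * (1 + x ^ 2)⁻¹ := by
        rw [pow_add]; ring
    _ = 2 * l.factorial * (((√n * θ) ^ (2 * e + k) * exp (-((√n * θ / π) ^ 2))) * (π ^ k)⁻¹ *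
          ((n : ℝ) ^ e)⁻¹ * ((J * √n) ^ k)⁻¹) * (1 + x ^ 2)⁻¹ := by
        rw [hne, hxk, pow_add]; ring
    _ ≤ 2 * l.factorial * ((1 + π ^ (2 * (2 * e + k)) * (2 * e + k).factorial) * (π ^ k)⁻¹ *
          ((n : ℝ) ^ e)⁻¹ * ((J * √n) ^ k)⁻¹) * (1 + x ^ 2)⁻¹ := by
        gcongr
    _ = _ := by ring

lemma TT_perr (M : ℕ) : ∀ (c b l e k : ℕ) (z : ℤ), c + b = 2 * e → z + b - l = M - 2 - k →
    ∃ C : ℝ, 0 < C ∧ ∀ (n p : ℕ) (J δ : ℝ), 1 ≤ n → n + 2 * M + 4 ≤ 2 * p → p + M ≤ 2 * n →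
      1 ≤ J → 0 < δ → ∀ t,
      |perr (TT p c b l z J δ) t| ≤ C * ((n : ℝ) ^ e)⁻¹ * ((J * √n) ^ k)⁻¹ := by
  induction M with
  | zero =>
    intro c b l e k z he hs
    obtain ⟨C, hC, hb⟩ := TT_pointwise c b l e k z he (by push_cast at hs; omega)
    obtain ⟨C₀, hC₀, hb₀⟩ := perr_crude
    refine ⟨C₀ * C, by positivity, ?_⟩
    intro n p J δ hn hp hp2 hJ hδ t
    have := hb₀ (TT p c b l z J δ) (C * ((n : ℝ) ^ e)⁻¹ * ((J * √n) ^ k)⁻¹) (by positivity)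
      (continuous_TT p c b l z J δ (by linarith) (by omega)) (hb n p J δ hn (by omega) hJ hδ) t
    calc _ ≤ _ := this
      _ = _ := by ring
  | succ M ih =>
    intro c b l e k z he hs
    push_cast at hs
    obtain ⟨C1, hC1, hb1⟩ := ih (c + 1) (b + 1) l (e + 1) k (z - 2) (by omega) (by push_cast; omega)
    obtain ⟨C2, hC2, hb2⟩ : ∃ C : ℝ, 0 < C ∧ ∀ (n p : ℕ) (J δ : ℝ), 1 ≤ n → n + 2 * M + 4 ≤ 2 * p →
        p + M ≤ 2 * n → 1 ≤ J → 0 < δ → ∀ t,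
        (c : ℝ) * |perr (TT p (c - 1) (b + 1) l (z - 2) J δ) t| ≤ C * ((n : ℝ) ^ e)⁻¹ * ((J * √n) ^ k)⁻¹ := by
      rcases Nat.eq_zero_or_pos c with h0 | h0
      · refine ⟨1, one_pos, ?_⟩
        intro n p J δ hn _ _ hJ _ t
        rw [h0]; simp only [Nat.cast_zero, zero_mul]; positivity
      · obtain ⟨C, hC, hb⟩ := ih (c - 1) (b + 1) l e k (z - 2) (by omega) (by push_cast; omega)
        refine ⟨c * C, by positivity, ?_⟩
        intro n p J δ hn h1 h2 hJ hδ t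
        rw [mul_assoc, mul_assoc, ← mul_assoc C]
        exact mul_le_mul_of_nonneg_left (hb n p J δ hn h1 h2 hJ hδ t) (by positivity)
    obtain ⟨C3, hC3, hb3⟩ := ih c b l e k (z - 1) he (by omega)
    obtain ⟨C4, hC4, hb4⟩ := ih c b (l + 1) e k z he (by push_cast; omega)
    refine ⟨2 * (2 * C1 + (C2 + (|(z : ℝ)| * C3 + C4))), by positivity, ?_⟩
    intro n p J δ hn hp hp2 hJ hδ t
    have hn0 : (0 : ℝ) < n := by exact_mod_cast hn
    have n1 := nice_TT (p - 1) (c + 1) (b + 1) l (z - 2) J δ hJ hδ (by omega)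
    have n2 := nice_TT (p + 1) (c - 1) (b + 1) l (z - 2) J δ hJ hδ (by omega)
    have n3 := nice_TT p c b l (z - 1) J δ hJ hδ (by omega)
    have n4 := nice_TT p c b (l + 1) z J δ hJ hδ (by omega)
    have n0 := nice_TT p c b l z J δ hJ hδ (by omega)
    have m34 := (n3.smul (z : ℝ)).add (n4.smul (-1))
    have m234 := (n2.smul (-(c : ℝ))).add m34
    have nd : NiceF (TTd p c b l z J δ) := (n1.smul (p : ℝ)).add m234
    have hstep := n0.perr_step nd (fun x => hasDerivAt_TT p c b l z J δ x (by linarith) (by omega))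
      ((2 * C1 + (C2 + (|(z : ℝ)| * C3 + C4))) * ((n : ℝ) ^ e)⁻¹ * ((J * √n) ^ k)⁻¹) ?_ t
    · calc _ ≤ _ := hstep
        _ = _ := by ring
    · intro s
      have ed : perr (TTd p c b l z J δ) s = (p : ℝ) * perr (TT (p - 1) (c + 1) (b + 1) l (z - 2) J δ) s
          + ((-(c : ℝ)) * perr (TT (p + 1) (c - 1) (b + 1) l (z - 2) J δ) s
          + ((z : ℝ) * perr (TT p c b l (z - 1) J δ) s + (-1) * perr (TT p c b (l + 1) z J δ) s)) := by
        rw [← perr_smul, ← perr_smul, ← perr_smul, ← perr_smul,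
          ← perr_add (n3.smul (z : ℝ)) (n4.smul (-1)), ← perr_add (n2.smul (-(c : ℝ))) m34,
          ← perr_add (n1.smul (p : ℝ)) m234]
        rfl
      rw [ed]
      have b1 := hb1 n (p - 1) J δ hn (by omega) (by omega) hJ hδ s
      have b2 := hb2 n (p + 1) J δ hn (by omega) (by omega) hJ hδ s
      have b3 := hb3 n p J δ hn (by omega) (by omega) hJ hδ s
      have b4 := hb4 n p J δ hn (by omega) (by omega) hJ hδ s
      have hpn : (p : ℝ) ≤ 2 * n := by
        have : p ≤ 2 * n := by omega
        exact_mod_cast this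
      have b1' : (p : ℝ) * |perr (TT (p - 1) (c + 1) (b + 1) l (z - 2) J δ) s|
          ≤ (2 * C1) * ((n : ℝ) ^ e)⁻¹ * ((J * √n) ^ k)⁻¹ := by
        calc _ ≤ (2 * n : ℝ) * (C1 * ((n : ℝ) ^ (e + 1))⁻¹ * ((J * √n) ^ k)⁻¹) := by gcongr
          _ = _ := by rw [pow_succ]; field_simp
      have b3' : |(z : ℝ)| * |perr (TT p c b l (z - 1) J δ) s|
          ≤ |(z : ℝ)| * (C3 * ((n : ℝ) ^ e)⁻¹ * ((J * √n) ^ k)⁻¹) := by gcongr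
      refine (abs_add_le _ _).trans ?_
      refine (add_le_add_right (abs_add_le _ _) _).trans ?_
      refine (add_le_add_right (add_le_add_right (abs_add_le _ _) _) _).trans ?_
      rw [abs_mul, abs_mul, abs_mul, abs_mul, abs_neg, abs_neg, abs_one, one_mul, Nat.abs_cast, Nat.abs_cast]
      calc _ ≤ _ := add_le_add b1' (add_le_add b2 (add_le_add b3' b4))
        _ = _ := by ring

/-- final error bound -/
lemma TT_perr_final (r : ℕ) : ∃ C : ℝ, 0 < C ∧ ∀ (n : ℕ) (J δ : ℝ), 2 * r + 22 ≤ n →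
      1 ≤ J → 0 < δ → ∀ t,
      |perr (TT n 2 0 0 ((r : ℤ) - 1) J δ) t| ≤ C * ((n : ℝ) ^ 5)⁻¹ * (J ^ 8)⁻¹ := by
  obtain ⟨C, hC, hb⟩ := TT_perr (r + 9) 2 0 0 1 8 ((r : ℤ) - 1) (by norm_num) (by push_cast; ring)
  refine ⟨C, hC, ?_⟩
  intro n J δ hn hJ hδ t
  have := hb n n J δ (by omega) (by omega) (by omega) hJ hδ t
  have hn0 : (0 : ℝ) < n := by
    have : 0 < n := by omega
    exact_mod_cast this
  calc _ ≤ _ := this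
    _ = _ := by
      have : √(n : ℝ) ^ 8 = (n : ℝ) ^ 4 := by
        rw [show 8 = 2 * 4 by norm_num, pow_mul, sq_sqrt hn0.le]
      rw [mul_pow, this]; field_simp

end

section
open Real MeasureTheory Filter Topology

/-- regularised shifted moments -/
noncomputable def AA (r n : ℕ) (δ : ℝ) : ℝ :=
  ∑ h ∈ Finset.range (n + 1), ((h : ℝ) + 2) ^ r * exp (-(δ * ((h : ℝ) + 2))) * (W n h / 2 ^ n)

/-- the doubly-indexed term -/
noncomputable def tj (r n : ℕ) (δ : ℝ) (j : ℕ) (x : ℝ) : ℝ :=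
  (-1) ^ j * TT n 2 0 0 ((r : ℤ) - 1) ((j : ℝ) + 1) δ x

lemma tj_abs_le (r n : ℕ) (δ : ℝ) (j H : ℕ) :
    |tj r n δ j H| ≤ if j < H then (H : ℝ) ^ r * exp (-(δ * H)) else 0 := by
  unfold tj TT
  rw [abs_mul, abs_pow, abs_neg, abs_one, one_pow, one_mul]
  by_cases h : 2 * ((j : ℝ) + 1) < H
  · have hj : j < H := by
      have : (j : ℝ) < H := by
        have : (0:ℝ) ≤ j := Nat.cast_nonneg j
        linarith
      exact_mod_cast this
    rw [if_pos h, if_pos hj]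
    have hH : (1 : ℝ) ≤ H := by
      have : 1 ≤ H := by omega
      exact_mod_cast this
    simp only [pow_zero, one_mul]
    rw [abs_mul, abs_mul, abs_pow, abs_pow]
    have h1 : |cos (((j : ℝ) + 1) * π / H)| ^ n ≤ 1 := pow_le_one₀ (abs_nonneg _) (abs_cos_le_one _)
    have h2 : |sin (((j : ℝ) + 1) * π / H)| ^ 2 ≤ 1 := pow_le_one₀ (abs_nonneg _) (abs_sin_le_one _)
    have h3 : |(H : ℝ) ^ ((r : ℤ) - 1) * exp (-(δ * H))| ≤ (H : ℝ) ^ r * exp (-(δ * H)) := by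
      rw [abs_of_nonneg (by positivity)]
      gcongr
      rw [← zpow_natCast]
      exact zpow_le_zpow_right₀ hH (by omega)
    have h12 := mul_le_one₀ h1 (by positivity) h2
    calc _ ≤ 1 * |(H : ℝ) ^ ((r : ℤ) - 1) * exp (-(δ * H))| := by gcongr
      _ ≤ _ := by rw [one_mul]; exact h3
  · rw [if_neg h, abs_zero]
    split_ifs <;> positivity

lemma summable_pow_exp (r : ℕ) (δ : ℝ) (hδ : 0 < δ) :
    Summable (fun H : ℕ => (H : ℝ) ^ r * exp (-(δ * H))) := by
  have := Real.summable_pow_mul_exp_neg_nat_mul r hδ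
  refine this.congr (fun H => ?_)
  rw [neg_mul]

lemma summable_tj (r n : ℕ) (δ : ℝ) (hδ : 0 < δ) :
    Summable (fun p : ℕ × ℕ => tj r n δ p.2 p.1) := by
  have hs : Summable (fun p : ℕ × ℕ => if p.2 < p.1 then (p.1 : ℝ) ^ r * exp (-(δ * p.1)) else 0) := by
    rw [summable_prod_of_nonneg (fun p => by dsimp only; split_ifs <;> positivity)]
    have hf : ∀ H : ℕ, HasSum (fun j : ℕ => if j < H then (H : ℝ) ^ r * exp (-(δ * H)) else 0)
        ((H : ℝ) ^ (r + 1) * exp (-(δ * H))) := by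
      intro H
      have := hasSum_sum_of_ne_finset_zero (L := SummationFilter.unconditional ℕ) (f := fun j : ℕ => if j < H then (H : ℝ) ^ r * exp (-(δ * H)) else 0)
        (s := Finset.range H) (fun b hb => by
          simp only [Finset.mem_range] at hb
          rw [if_neg hb])
      convert this using 1
      rw [Finset.sum_congr rfl (g := fun _ => (H : ℝ) ^ r * exp (-(δ * H)))]
      · simp; ring
      · intro x hx
        rw [if_pos (Finset.mem_range.mp hx)]
    refine ⟨fun H => (hf H).summable, ?_⟩
    refine (summable_pow_exp (r + 1) δ hδ).congr (fun H => ?_)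
    exact (hf H).tsum_eq.symm
  refine Summable.of_norm_bounded hs (fun p => ?_)
  exact tj_abs_le r n δ p.2 p.1

lemma lattice_sum (n : ℕ) (F : ℝ → ℝ) (hF : ∀ x ≤ 2, F x = 0) :
    ∑' H : ℕ, (1 + (-1 : ℝ) ^ (H + n)) * F H = 2 * ∑' m : ℤ, F ((n : ℝ) + 2 * m) := by
  set g : ℤ → ℝ := fun k => if Even (k + n) then 2 * F k else 0 with hg
  have e1 : ∑' H : ℕ, g (H : ℤ) = ∑' k : ℤ, g k := by
    refine Function.Injective.tsum_eq (g := fun H : ℕ => (H : ℤ)) Nat.cast_injective ?_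
    intro k hk
    rw [Function.mem_support] at hk
    by_contra hne
    apply hk
    have : k < 0 := by
      by_contra h
      exact hne ⟨k.toNat, by simp; omega⟩
    rw [hg]; dsimp only
    rw [hF, mul_zero, ite_self]
    have : (k : ℝ) < 0 := by exact_mod_cast this
    linarith
  have e2 : ∑' m : ℤ, g ((n : ℤ) + 2 * m) = ∑' k : ℤ, g k := by
    refine Function.Injective.tsum_eq (g := fun m : ℤ => (n : ℤ) + 2 * m) ?_ ?_
    · intro a b h
      simp only at h
      omega
    · intro k hk
      rw [Function.mem_support] at hk
      by_contra hne
      apply hk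
      rw [hg]; dsimp only
      rw [if_neg]
      rintro ⟨q, hq⟩
      exact hne ⟨q - n, by simp only; omega⟩
  have e3 : ∀ m : ℤ, g ((n : ℤ) + 2 * m) = 2 * F ((n : ℝ) + 2 * m) := by
    intro m
    rw [hg]; dsimp only
    rw [if_pos ⟨n + m, by ring⟩]
    push_cast; rfl
  have e4 : ∀ H : ℕ, g (H : ℤ) = (1 + (-1 : ℝ) ^ (H + n)) * F H := by
    intro H
    rw [hg]; dsimp only
    by_cases he : Even (H + n)
    · rw [if_pos (by exact_mod_cast he), he.neg_one_pow]; push_cast; norm_num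
    · rw [if_neg (by exact_mod_cast he), (Nat.not_even_iff_odd.mp he).neg_one_pow]; norm_num
  rw [← tsum_mul_left]
  simp only [← e3, ← e4]
  rw [e1, e2]

lemma tj_zero (r n : ℕ) (δ : ℝ) (j : ℕ) (x : ℝ) (hx : x ≤ 2) : tj r n δ j x = 0 := by
  unfold tj TT
  rw [if_neg, mul_zero]
  have : (0:ℝ) ≤ j := Nat.cast_nonneg j
  linarith

lemma AA_term (r n : ℕ) (hn : 1 ≤ n) (δ : ℝ) (h : ℕ) :
    ((h : ℝ) + 2) ^ r * exp (-(δ * ((h : ℝ) + 2))) * (W n h / 2 ^ n) =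
    2 * ∑' j : ℕ, (1 + (-1 : ℝ) ^ ((h + 2) + n)) * tj r n δ j ((h + 2 : ℕ) : ℝ) := by
  rw [W_fold n h hn, tsum_mul_left]
  rw [tsum_eq_sum (s := Finset.range (h + 1)) (fun j hj => by
    have h1 := tj_abs_le r n δ j (h + 2)
    simp only [Finset.mem_range, not_lt] at hj
    by_cases h2 : j = h + 1
    · unfold tj TT
      rw [if_neg, mul_zero]
      push_cast
      rw [h2]; push_cast
      have : (0:ℝ) ≤ h := Nat.cast_nonneg h
      linarith
    · rw [if_neg (by omega)] at h1
      exact abs_nonpos_iff.mp h1)]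
  rw [Finset.sum_range_succ' _ (h + 1)]
  simp only [lt_self_iff_false, false_and, if_false, add_zero]
  have hz : ((h : ℝ) + 2) ^ ((r : ℤ) - 1) = ((h : ℝ) + 2) ^ r / ((h : ℝ) + 2) := by
    rw [zpow_sub₀ (by positivity), zpow_one, zpow_natCast]
  have hterm : ∀ j ∈ Finset.range (h + 1), tj r n δ j ((h + 2 : ℕ) : ℝ) =
      (((h : ℝ) + 2) ^ r / ((h : ℝ) + 2) * exp (-(δ * ((h : ℝ) + 2)))) *
      (if (0 < j + 1 ∧ 2 * (j + 1) < h + 2) then (-1 : ℝ) ^ (j + 1 + 1) *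
        cos ((j + 1 : ℕ) * π / (h + 2)) ^ n * sin ((j + 1 : ℕ) * π / (h + 2)) ^ 2 else 0) := by
    intro j _
    unfold tj TT
    by_cases hc : 2 * (j + 1) < h + 2
    · rw [if_pos (by exact_mod_cast hc), if_pos ⟨by omega, hc⟩]
      push_cast
      rw [hz]
      ring
    · rw [if_neg (by exact_mod_cast hc), if_neg (by tauto)]
      ring
  rw [Finset.sum_congr rfl hterm, ← Finset.mul_sum]
  generalize (∑ x ∈ Finset.range (h + 1),
        if 0 < x + 1 ∧ 2 * (x + 1) < h + 2 then
          (-1 : ℝ) ^ (x + 1 + 1) * cos ((x + 1 : ℕ) * π / (h + 2)) ^ n * sin ((x + 1 : ℕ) * π / (h + 2)) ^ 2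
        else 0) = S
  have : ((h : ℝ) + 2) ≠ 0 := by positivity
  field_simp

lemma AA_swap (r n : ℕ) (hn : 1 ≤ n) (δ : ℝ) (hδ : 0 < δ) :
    Summable (fun j : ℕ => ∑' m : ℤ, tj r n δ j ((n : ℝ) + 2 * m)) ∧
    AA r n δ = 4 * ∑' j : ℕ, ∑' m : ℤ, tj r n δ j ((n : ℝ) + 2 * m) := by
  have hs0 := summable_tj r n δ hδ
  have hs : Summable (fun p : ℕ × ℕ => (1 + (-1 : ℝ) ^ (p.1 + n)) * tj r n δ p.2 p.1) := by
    refine Summable.of_norm_bounded (hs0.norm.mul_left 2) (fun p => ?_)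
    rw [norm_mul]
    gcongr
    refine (norm_add_le _ _).trans ?_
    simp; norm_num
  have e1 : AA r n δ = ∑' h : ℕ, 2 * ∑' j : ℕ, (1 + (-1 : ℝ) ^ ((h + 2) + n)) * tj r n δ j ((h + 2 : ℕ) : ℝ) := by
    unfold AA
    rw [← tsum_eq_sum (L := SummationFilter.unconditional ℕ) (fun h hh => by
      rw [W_eq_zero n h (by simpa using hh)]; simp)]
    exact tsum_congr (fun h => AA_term r n hn δ h)
  have e2 : ∑' h : ℕ, ∑' j : ℕ, (1 + (-1 : ℝ) ^ ((h + 2) + n)) * tj r n δ j ((h + 2 : ℕ) : ℝ)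
     = ∑' H : ℕ, ∑' j : ℕ, (1 + (-1 : ℝ) ^ (H + n)) * tj r n δ j (H : ℝ) := by
    refine Function.Injective.tsum_eq (g := fun h : ℕ => h + 2)
      (f := fun H : ℕ => ∑' j : ℕ, (1 + (-1 : ℝ) ^ (H + n)) * tj r n δ j (H : ℝ))
      (add_left_injective 2) ?_
    intro H hH
    rw [Function.mem_support] at hH
    by_contra hne
    apply hH
    have hH2 : H < 2 := by
      by_contra h
      exact hne ⟨H - 2, by simp only; omega⟩
    have : ∀ j : ℕ, (1 + (-1 : ℝ) ^ (H + n)) * tj r n δ j (H : ℝ) = 0 := by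
      intro j
      rw [tj_zero r n δ j, mul_zero]
      have : (H : ℝ) < 2 := by exact_mod_cast hH2
      linarith
    simp only [this, tsum_zero]
  have e3 : ∀ j : ℕ, ∑' H : ℕ, (1 + (-1 : ℝ) ^ (H + n)) * tj r n δ j H =
      2 * ∑' m : ℤ, tj r n δ j ((n : ℝ) + 2 * m) := fun j =>
    lattice_sum n (tj r n δ j) (tj_zero r n δ j)
  have hsw := hs.prod_symm.prod
  simp only [Prod.swap] at hsw
  constructor
  · refine (hsw.mul_left (1 / 2)).congr (fun j => ?_)
    rw [e3]; ring
  · rw [e1, tsum_mul_left, e2, ← Summable.tsum_comm (f := fun H j : ℕ => (1 + (-1 : ℝ) ^ (H + n)) * tj r n δ j (H : ℝ)) hs, tsum_congr e3,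
      tsum_mul_left]
    ring

lemma tj_split (r n : ℕ) (δ : ℝ) (j : ℕ) :
    ∑' m : ℤ, tj r n δ j ((n : ℝ) + 2 * m) = (-1) ^ j * perr (TT n 2 0 0 ((r : ℤ) - 1) ((j : ℝ) + 1) δ) n
      + (1 / 2) * ∫ x, tj r n δ j x := by
  unfold perr tj
  rw [tsum_mul_left, integral_const_mul]
  ring

lemma AA_main (r : ℕ) : ∃ C : ℝ, 0 < C ∧ ∀ (n : ℕ) (δ : ℝ), 2 * r + 22 ≤ n → 0 < δ →
    |AA r n δ - 2 * ∑' j : ℕ, ∫ x, tj r n δ j x| ≤ C * ((n : ℝ) ^ 5)⁻¹ := by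
  obtain ⟨C, hC, hb⟩ := TT_perr_final r
  have hsum : Summable (fun j : ℕ => (((j : ℝ) + 1) ^ 8)⁻¹) := by
    have h := (summable_nat_add_iff 1).mpr (Real.summable_nat_pow_inv.mpr (by norm_num : 1 < 8))
    refine h.congr (fun j => ?_)
    push_cast; rfl
  refine ⟨4 * (C * ∑' j : ℕ, (((j : ℝ) + 1) ^ 8)⁻¹), ?_, ?_⟩
  · have : 0 < ∑' j : ℕ, (((j : ℝ) + 1) ^ 8)⁻¹ :=
      hsum.tsum_pos (fun j => by positivity) 0 (by positivity)
    positivity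
  intro n δ hn hδ
  obtain ⟨hs, he⟩ := AA_swap r n (by omega) δ hδ
  set pe : ℕ → ℝ := fun j => (-1) ^ j * perr (TT n 2 0 0 ((r : ℤ) - 1) ((j : ℝ) + 1) δ) n with hpe
  have hpb : ∀ j, ‖pe j‖ ≤ C * ((n : ℝ) ^ 5)⁻¹ * (((j : ℝ) + 1) ^ 8)⁻¹ := by
    intro j
    rw [hpe]; dsimp only
    rw [norm_mul, norm_pow, norm_neg, norm_one, one_pow, one_mul]
    refine hb n _ δ hn ?_ hδ _
    have : (0:ℝ) ≤ j := Nat.cast_nonneg j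
    linarith
  have hps : Summable pe := Summable.of_norm_bounded (hsum.mul_left _) hpb
  have hsi : Summable (fun j : ℕ => ∫ x, tj r n δ j x) := by
    refine ((hs.sub hps).mul_left 2).congr (fun j => ?_)
    rw [tj_split]; rw [hpe]; ring
  have e : ∑' j : ℕ, ∑' m : ℤ, tj r n δ j ((n : ℝ) + 2 * m) = ∑' j, pe j + (1/2) * ∑' j : ℕ, ∫ x, tj r n δ j x := by
    rw [← tsum_mul_left, ← hps.tsum_add (hsi.mul_left _)]
    exact tsum_congr (fun j => tj_split r n δ j)
  rw [he, e]
  have hnorm := tsum_of_norm_bounded (hsum.mul_left (C * ((n : ℝ) ^ 5)⁻¹)).hasSum hpb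
  rw [tsum_mul_left, Real.norm_eq_abs] at hnorm
  rw [show 4 * (∑' j, pe j + (1/2) * ∑' j : ℕ, ∫ x, tj r n δ j x) - 2 * ∑' j : ℕ, ∫ x, tj r n δ j x = 4 * ∑' j, pe j by ring, abs_mul, abs_of_pos (by norm_num : (0:ℝ) < 4)]
  nlinarith

end

section
open Real MeasureTheory Filter Topology

/-- alternating sums -/
noncomputable def Em (r : ℕ) (u : ℝ) : ℝ := ∑' j : ℕ, (-1) ^ j * ((j : ℝ) + 1) ^ r * exp (-((j + 1) * u))

lemma Em_exp (j : ℕ) (u : ℝ) : exp (-((j + 1) * u)) = exp (-u) * exp (-u) ^ j := by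
  rw [← pow_succ', ← exp_nat_mul]; push_cast; ring_nf

lemma Em_zero (u : ℝ) (hu : 0 < u) : Em 0 u = exp (-u) / (1 + exp (-u)) := by
  have hq : ‖-exp (-u)‖ < 1 := by
    rw [norm_neg, Real.norm_of_nonneg (exp_pos _).le]; exact exp_lt_one_iff.mpr (by linarith)
  have h := (hasSum_geometric_of_norm_lt_one hq).mul_left (exp (-u))
  unfold Em
  rw [sub_neg_eq_add, ← div_eq_mul_inv] at h
  rw [← h.tsum_eq]
  refine tsum_congr (fun j => ?_)
  rw [Em_exp, neg_pow (exp (-u))]; ring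

lemma Em_one (u : ℝ) (hu : 0 < u) : Em 1 u = exp (-u) / (1 + exp (-u)) ^ 2 := by
  have hq : ‖-exp (-u)‖ < 1 := by
    rw [norm_neg, Real.norm_of_nonneg (exp_pos _).le]; exact exp_lt_one_iff.mpr (by linarith)
  have h := (hasSum_choose_mul_geometric_of_norm_lt_one' 1 hq).mul_left (exp (-u))
  unfold Em
  rw [sub_neg_eq_add, Ring.inverse_eq_inv', inv_pow, ← div_eq_mul_inv] at h
  rw [← h.tsum_eq]
  refine tsum_congr (fun j => ?_)
  rw [Em_exp, neg_pow (exp (-u)), Nat.choose_one_right]; push_cast; ring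

lemma Em_two (u : ℝ) (hu : 0 < u) : Em 2 u = exp (-u) * (1 - exp (-u)) / (1 + exp (-u)) ^ 3 := by
  have hq : ‖-exp (-u)‖ < 1 := by
    rw [norm_neg, Real.norm_of_nonneg (exp_pos _).le]; exact exp_lt_one_iff.mpr (by linarith)
  have h1 := (hasSum_choose_mul_geometric_of_norm_lt_one' 1 hq).mul_left (exp (-u))
  have h2 := (hasSum_choose_mul_geometric_of_norm_lt_one' 2 hq).mul_left (2 * exp (-u))
  have h := h2.sub h1
  unfold Em
  rw [sub_neg_eq_add, Ring.inverse_eq_inv', inv_pow, inv_pow] at h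
  have h0 : 1 + exp (-u) ≠ 0 := by positivity
  have e : exp (-u) * (1 - exp (-u)) / (1 + exp (-u)) ^ 3 =
    2 * exp (-u) * ((1 + exp (-u)) ^ (2 + 1))⁻¹ - exp (-u) * ((1 + exp (-u)) ^ (1 + 1))⁻¹ := by
    field_simp; ring
  rw [e, ← h.tsum_eq]
  refine tsum_congr (fun j => ?_)
  have hc : ((j + 2).choose 2 : ℝ) = ((j : ℝ) + 2) * (j + 1) / 2 := by
    rw [Nat.cast_choose_two]; push_cast; ring
  rw [Em_exp, neg_pow (exp (-u)), Nat.choose_one_right, hc]; push_cast; ring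

/-- the kernel in the `y` variable -/
noncomputable def gg (n r : ℕ) (y : ℝ) : ℝ := cos (π / y) ^ n * sin (π / y) ^ 2 * y ^ ((r : ℤ) - 1)

lemma continuousOn_gg (n r : ℕ) : ContinuousOn (gg n r) (Set.Ioi 0) := by
  have h : ContinuousOn (fun y : ℝ => π / y) (Set.Ioi 0) :=
    continuousOn_const.div continuousOn_id (fun y hy => (ne_of_gt hy))
  refine (((continuous_cos.comp_continuousOn h).pow n).mul ((continuous_sin.comp_continuousOn h).pow 2)).mul ?_
  exact continuousOn_id.zpow₀ _ (fun y hy => Or.inl (ne_of_gt hy))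

lemma abs_gg_le (n r : ℕ) (y : ℝ) (hy : 0 < y) : |gg n r y| ≤ y ^ ((r : ℤ) - 1) := by
  unfold gg
  rw [abs_mul, abs_mul, abs_pow, abs_pow, abs_of_pos (zpow_pos hy _)]
  have h1 : |cos (π / y)| ^ n ≤ 1 := pow_le_one₀ (abs_nonneg _) (abs_cos_le_one _)
  have h2 : |sin (π / y)| ^ 2 ≤ 1 := pow_le_one₀ (abs_nonneg _) (abs_sin_le_one _)
  have h12 := mul_le_one₀ h1 (by positivity) h2
  calc _ ≤ 1 * y ^ ((r : ℤ) - 1) := by gcongr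
    _ = _ := one_mul _

lemma integral_tj (r n : ℕ) (δ : ℝ) (j : ℕ) :
    ∫ x, tj r n δ j x = ∫ y in Set.Ioi (2 : ℝ), gg n r y * ((-1) ^ j * ((j : ℝ) + 1) ^ r * exp (-((j + 1) * (δ * y)))) := by
  have hJ : (0 : ℝ) < (j : ℝ) + 1 := by positivity
  have h := Measure.integral_comp_mul_left (tj r n δ j) ((j : ℝ) + 1)
  rw [abs_of_pos (inv_pos.mpr hJ), smul_eq_mul] at h
  have h2 : ∫ x, tj r n δ j x = ∫ x, ((j : ℝ) + 1) * tj r n δ j (((j : ℝ) + 1) * x) := by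
    rw [integral_const_mul, h]; field_simp
  rw [h2, ← integral_indicator measurableSet_Ioi]
  congr 1
  ext y
  unfold tj TT
  by_cases hy : 2 < y
  · have h3 : 2 * ((j : ℝ) + 1) < ((j : ℝ) + 1) * y := by nlinarith
    rw [if_pos h3, Set.indicator_of_mem (show y ∈ Set.Ioi 2 from hy)]
    have e1 : ((j : ℝ) + 1) * π / (((j : ℝ) + 1) * y) = π / y := by
      rw [mul_div_mul_left _ _ hJ.ne']
    have e2 : (((j : ℝ) + 1) * y) ^ ((r : ℤ) - 1) = ((j : ℝ) + 1) ^ r / ((j : ℝ) + 1) * y ^ ((r : ℤ) - 1) := by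
      rw [mul_zpow, zpow_sub₀ hJ.ne' (r : ℤ) 1, zpow_one, zpow_natCast]
    rw [e1, e2, show δ * (((j : ℝ) + 1) * y) = (j + 1) * (δ * y) by ring]
    unfold gg
    simp only [pow_zero, one_mul]
    field_simp
  · have h3 : ¬ (2 * ((j : ℝ) + 1) < ((j : ℝ) + 1) * y) := by nlinarith
    rw [if_neg h3, Set.indicator_of_notMem (show y ∉ Set.Ioi 2 from hy)]
    ring

lemma integrableOn_pow_exp (r : ℕ) (b : ℝ) (hb : 0 < b) :
    IntegrableOn (fun y : ℝ => y ^ r * exp (-(b * y))) (Set.Ioi 2) := by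
  have h := integrableOn_rpow_mul_exp_neg_mul_rpow (p := 1) (s := r) (b := b)
    (by have : (0:ℝ) ≤ r := Nat.cast_nonneg r
        linarith) one_pos hb
  have h2 := h.mono_set (Set.Ioi_subset_Ioi (by norm_num : (0 : ℝ) ≤ 2))
  refine h2.congr_fun (fun y hy => ?_) measurableSet_Ioi
  simp [rpow_natCast]

lemma sum_integral_tj (r n : ℕ) (δ : ℝ) (hδ : 0 < δ) :
    ∑' j : ℕ, ∫ x, tj r n δ j x = ∫ y in Set.Ioi (2 : ℝ), gg n r y * Em r (δ * y) := by
  set F : ℕ → ℝ → ℝ := fun j y => gg n r y * ((-1) ^ j * ((j : ℝ) + 1) ^ r * exp (-((j + 1) * (δ * y)))) with hF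
  have hb : ∀ j : ℕ, ∀ y ∈ Set.Ioi (2 : ℝ), ‖F j y‖ ≤
      (((j : ℝ) + 1) ^ r * exp (-(δ * (j + 1)))) * (y ^ r * exp (-((δ / 2) * y))) := by
    intro j y hy
    have hy : 2 < y := hy
    have hj : (0:ℝ) ≤ j := Nat.cast_nonneg j
    rw [hF]; dsimp only
    rw [Real.norm_eq_abs, abs_mul, abs_mul, abs_mul, abs_pow, abs_neg, abs_one, one_pow, one_mul,
      abs_of_nonneg (by positivity : 0 ≤ ((j : ℝ) + 1) ^ r), abs_of_pos (exp_pos _)]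
    have h1 : |gg n r y| ≤ y ^ r := by
      refine (abs_gg_le n r y (by linarith)).trans ?_
      rw [← zpow_natCast]
      exact zpow_le_zpow_right₀ (by linarith) (by omega)
    have h2 : exp (-((j + 1) * (δ * y))) ≤ exp (-(δ * (j + 1))) * exp (-((δ / 2) * y)) := by
      rw [← exp_add]
      apply exp_le_exp.mpr
      have : 0 ≤ δ * (((j : ℝ) + 1 / 2) * (y - 1) - 1 / 2) := by
        apply mul_nonneg hδ.le; nlinarith
      nlinarith
    calc _ ≤ y ^ r * (((j : ℝ) + 1) ^ r * (exp (-(δ * (j + 1))) * exp (-((δ / 2) * y)))) := by gcongr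
      _ = _ := by ring
  have hIntg := integrableOn_pow_exp r (δ / 2) (by linarith)
  have hFi : ∀ j, Integrable (F j) (volume.restrict (Set.Ioi (2 : ℝ))) := by
    intro j
    refine Integrable.mono' (hIntg.const_mul (((j : ℝ) + 1) ^ r * exp (-(δ * (j + 1))))) ?_ ?_
    · refine ContinuousOn.aestronglyMeasurable ?_ measurableSet_Ioi
      refine ((continuousOn_gg n r).mono (Set.Ioi_subset_Ioi (by norm_num))).mul ?_
      fun_prop
    · exact (ae_restrict_mem measurableSet_Ioi).mono (fun y hy => hb j y hy)
  have hsum : Summable (fun j : ℕ => ((j : ℝ) + 1) ^ r * exp (-(δ * (j + 1)))) := by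
    have := (summable_nat_add_iff 1).mpr (summable_pow_exp r δ hδ)
    refine this.congr (fun j => ?_)
    push_cast; rfl
  have hFs : Summable fun j => ∫ y in Set.Ioi (2 : ℝ), ‖F j y‖ := by
    refine Summable.of_nonneg_of_le (fun j => integral_nonneg (fun y => norm_nonneg _)) (fun j => ?_)
      (hsum.mul_right (∫ y in Set.Ioi (2 : ℝ), y ^ r * exp (-((δ / 2) * y))))
    rw [← integral_const_mul]
    refine setIntegral_mono_on (hFi j).norm (hIntg.const_mul _) measurableSet_Ioi (fun y hy => hb j y hy)
  have := (hasSum_integral_of_summable_integral_norm hFi hFs).tsum_eq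
  simp only [hF, ← integral_tj] at this
  rw [this]
  refine setIntegral_congr_fun measurableSet_Ioi (fun y hy => ?_)
  simp only [tsum_mul_left]
  rfl

/-- the shifted moments -/
noncomputable def ss (r n : ℕ) : ℝ :=
  ∑ h ∈ Finset.range (n + 1), ((h : ℝ) + 2) ^ r * (W n h / 2 ^ n)

lemma AA_tendsto (r n : ℕ) : Tendsto (fun δ => AA r n δ) (𝓝[>] 0) (𝓝 (ss r n)) := by
  have : Continuous (fun δ => AA r n δ) := by
    unfold AA
    fun_prop
  have h := (this.tendsto 0).mono_left (nhdsWithin_le_nhds (s := Set.Ioi 0))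
  have e : AA r n 0 = ss r n := by
    unfold AA ss; simp
  rwa [e] at h

/-- if the main term converges, the moments are close to the limit -/
lemma ss_close (r : ℕ) : ∃ C : ℝ, 0 < C ∧ ∀ (n : ℕ) (M : ℝ), 2 * r + 22 ≤ n →
    Tendsto (fun δ => ∫ y in Set.Ioi (2 : ℝ), gg n r y * Em r (δ * y)) (𝓝[>] 0) (𝓝 M) →
    |ss r n - 2 * M| ≤ C * ((n : ℝ) ^ 5)⁻¹ := by
  obtain ⟨C, hC, hb⟩ := AA_main r
  refine ⟨C, hC, fun n M hn hM => ?_⟩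
  have ht : Tendsto (fun δ => |AA r n δ - 2 * ∑' j : ℕ, ∫ x, tj r n δ j x|) (𝓝[>] 0) (𝓝 |ss r n - 2 * M|) := by
    refine ((AA_tendsto r n).sub (Tendsto.const_mul 2 (hM.congr' ?_))).abs
    filter_upwards [self_mem_nhdsWithin] with δ hδ
    exact (sum_integral_tj r n δ hδ).symm
  refine le_of_tendsto ht ?_
  filter_upwards [self_mem_nhdsWithin] with δ hδ
  exact hb n δ hn hδ

lemma sin_pi_div_sq_le (y : ℝ) (hy : 0 < y) : sin (π / y) ^ 2 ≤ π ^ 2 / y ^ 2 := by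
  rw [← div_pow]
  have := abs_sin_le_abs (x := π / y)
  exact sq_le_sq.mpr this

lemma abs_gg_le' (n r : ℕ) (y : ℝ) (hy : 0 < y) : |gg n r y| ≤ π ^ 2 * y ^ ((r : ℤ) - 3) := by
  unfold gg
  rw [abs_mul, abs_mul, abs_pow, abs_of_pos (zpow_pos hy _), abs_of_nonneg (sq_nonneg (sin (π / y)))]
  have h1 : |cos (π / y)| ^ n ≤ 1 := pow_le_one₀ (abs_nonneg _) (abs_cos_le_one _)
  have h2 := sin_pi_div_sq_le y hy
  calc _ ≤ 1 * (π ^ 2 / y ^ 2) * y ^ ((r : ℤ) - 1) := by gcongr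
    _ = _ := by
      rw [show (r : ℤ) - 3 = (r : ℤ) - 1 - 2 by ring, zpow_sub₀ hy.ne' _ 2]
      norm_cast
      ring

lemma limit01 (n r : ℕ) (hr : r ≤ 1) (L : ℝ) (hL : Tendsto (Em r) (𝓝[>] 0) (𝓝 L))
    (hbd : ∀ u, 0 < u → |Em r u| ≤ 1) (hc : ContinuousOn (Em r) (Set.Ioi 0)) :
    Tendsto (fun δ => ∫ y in Set.Ioi (2 : ℝ), gg n r y * Em r (δ * y)) (𝓝[>] 0)
      (𝓝 (∫ y in Set.Ioi (2 : ℝ), gg n r y * L)) := by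
  refine tendsto_integral_filter_of_dominated_convergence (fun y => π ^ 2 * y ^ ((r : ℝ) - 3)) ?_ ?_ ?_ ?_
  · filter_upwards [self_mem_nhdsWithin] with δ hδ
    refine ContinuousOn.aestronglyMeasurable ?_ measurableSet_Ioi
    refine ((continuousOn_gg n r).mono (Set.Ioi_subset_Ioi (by norm_num))).mul ?_
    refine hc.comp (by fun_prop) (fun y hy => ?_)
    have hy : 2 < y := hy
    exact mul_pos (show 0 < δ from hδ) (show 0 < y by linarith)
  · filter_upwards [self_mem_nhdsWithin] with δ hδ
    refine (ae_restrict_mem measurableSet_Ioi).mono (fun y hy => ?_)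
    have hy : 2 < y := hy
    rw [norm_mul]
    have h1 := abs_gg_le' n r y (by linarith)
    have h2 := hbd (δ * y) (mul_pos hδ (by linarith))
    calc _ ≤ (π ^ 2 * y ^ ((r : ℤ) - 3)) * 1 := mul_le_mul h1 h2 (abs_nonneg _) (by positivity)
      _ = _ := by
        rw [mul_one, ← rpow_intCast]; push_cast; rfl
  · refine Integrable.const_mul ?_ _
    refine integrableOn_Ioi_rpow_of_lt ?_ (by norm_num)
    have : (r : ℝ) ≤ 1 := by exact_mod_cast hr
    linarith
  · refine (ae_restrict_mem measurableSet_Ioi).mono (fun y hy => ?_)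
    have hy : 2 < y := hy
    refine Tendsto.const_mul _ (hL.comp ?_)
    refine tendsto_nhdsWithin_iff.mpr ⟨?_, ?_⟩
    · have : Tendsto (fun δ : ℝ => δ * y) (𝓝 0) (𝓝 (0 * y)) := tendsto_id.mul_const y
      rw [zero_mul] at this
      exact this.mono_left nhdsWithin_le_nhds
    · filter_upwards [self_mem_nhdsWithin] with δ hδ
      exact mul_pos (show 0 < δ from hδ) (show 0 < y by linarith)

lemma tendsto_exp_neg_zero : Tendsto (fun u : ℝ => exp (-u)) (𝓝[>] 0) (𝓝 1) := by
  have : Continuous (fun u : ℝ => exp (-u)) := by fun_prop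
  have h := this.tendsto 0
  rw [neg_zero, exp_zero] at h
  exact h.mono_left nhdsWithin_le_nhds

lemma ss_zero_close : ∃ C : ℝ, 0 < C ∧ ∀ n : ℕ, 22 ≤ n →
    |ss 0 n - ∫ y in Set.Ioi (2 : ℝ), gg n 0 y| ≤ C * ((n : ℝ) ^ 5)⁻¹ := by
  obtain ⟨C, hC, hb⟩ := ss_close 0
  refine ⟨C, hC, fun n hn => ?_⟩
  have hE : Set.EqOn (Em 0) (fun u => exp (-u) / (1 + exp (-u))) (Set.Ioi 0) := fun u hu => Em_zero u hu
  have h := hb n _ (by omega) (limit01 n 0 (by norm_num) (1 / 2) ?_ ?_ ?_)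
  · rw [integral_mul_const] at h
    convert h using 2
    ring_nf
  · have : Tendsto (fun u : ℝ => exp (-u) / (1 + exp (-u))) (𝓝[>] 0) (𝓝 (1 / (1 + 1))) :=
      tendsto_exp_neg_zero.div (tendsto_const_nhds.add tendsto_exp_neg_zero) (by norm_num)
    rw [one_add_one_eq_two] at this
    refine this.congr' ?_
    filter_upwards [self_mem_nhdsWithin] with u hu
    exact (hE hu).symm
  · intro u hu
    rw [Em_zero u hu, abs_of_pos (by positivity), div_le_one (by positivity)]
    linarith
  · refine ContinuousOn.congr ?_ hE
    refine ContinuousOn.div (by fun_prop) (by fun_prop) (fun u _ => by positivity)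

lemma ss_one_close : ∃ C : ℝ, 0 < C ∧ ∀ n : ℕ, 24 ≤ n →
    |ss 1 n - (1 / 2) * ∫ y in Set.Ioi (2 : ℝ), gg n 1 y| ≤ C * ((n : ℝ) ^ 5)⁻¹ := by
  obtain ⟨C, hC, hb⟩ := ss_close 1
  refine ⟨C, hC, fun n hn => ?_⟩
  have hE : Set.EqOn (Em 1) (fun u => exp (-u) / (1 + exp (-u)) ^ 2) (Set.Ioi 0) := fun u hu => Em_one u hu
  have h := hb n _ (by omega) (limit01 n 1 (by norm_num) (1 / 4) ?_ ?_ ?_)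
  · rw [integral_mul_const] at h
    convert h using 2
    ring_nf
  · have : Tendsto (fun u : ℝ => exp (-u) / (1 + exp (-u)) ^ 2) (𝓝[>] 0) (𝓝 (1 / (1 + 1) ^ 2)) :=
      tendsto_exp_neg_zero.div ((tendsto_const_nhds.add tendsto_exp_neg_zero).pow 2) (by norm_num)
    rw [show (1 : ℝ) / (1 + 1) ^ 2 = 1 / 4 by norm_num] at this
    refine this.congr' ?_
    filter_upwards [self_mem_nhdsWithin] with u hu
    exact (hE hu).symm
  · intro u hu
    rw [Em_one u hu, abs_of_pos (by positivity), div_le_one (by positivity)]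
    nlinarith [exp_pos (-u)]
  · refine ContinuousOn.congr ?_ hE
    refine ContinuousOn.div (by fun_prop) (by fun_prop) (fun u _ => by positivity)

end

section
open Real MeasureTheory Filter Topology

lemma Em_two_abs (u : ℝ) (hu : 0 < u) : |Em 2 u| / u ≤ exp (-u) := by
  have h1 : exp (-u) ≤ 1 := exp_le_one_iff.mpr (by linarith)
  have h2 : 1 - u ≤ exp (-u) := one_sub_le_exp_neg u
  have hq := exp_pos (-u)
  rw [Em_two u hu, abs_of_nonneg (div_nonneg (mul_nonneg hq.le (by linarith)) (by positivity)),
    div_le_iff₀ hu, div_le_iff₀ (by positivity)]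
  have h3 : 1 ≤ (1 + exp (-u)) ^ 3 := one_le_pow₀ (by linarith)
  calc _ ≤ exp (-u) * u * 1 := by rw [mul_one]; gcongr; linarith
    _ ≤ _ := by gcongr

lemma continuousOn_Em_two : ContinuousOn (Em 2) (Set.Ioi 0) := by
  have hE : Set.EqOn (Em 2) (fun u => exp (-u) * (1 - exp (-u)) / (1 + exp (-u)) ^ 3) (Set.Ioi 0) :=
    fun u hu => Em_two u hu
  refine ContinuousOn.congr ?_ hE
  refine ContinuousOn.div (by fun_prop) (by fun_prop) (fun u _ => by positivity)

/-- rescaled kernel -/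
noncomputable def KK (n : ℕ) (δ u : ℝ) : ℝ :=
  π ^ 2 / u * (cos (π * δ / u) ^ n * sinc (π * δ / u) ^ 2)

lemma limit2_rescale (n : ℕ) (δ : ℝ) (hδ : 0 < δ) :
    ∫ y in Set.Ioi (2 : ℝ), gg n 2 y * Em 2 (δ * y) =
    ∫ u in Set.Ioi (0 : ℝ), (Set.Ioi (2 * δ)).indicator (fun u => KK n δ u * Em 2 u) u := by
  have h := integral_comp_mul_left_Ioi (fun u => gg n 2 (u / δ) * Em 2 u) 2 hδ
  have e1 : ∫ y in Set.Ioi (2 : ℝ), gg n 2 y * Em 2 (δ * y) =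
      ∫ y in Set.Ioi (2 : ℝ), gg n 2 (δ * y / δ) * Em 2 (δ * y) := by
    refine setIntegral_congr_fun measurableSet_Ioi (fun y _ => ?_)
    simp only [mul_div_cancel_left₀ y hδ.ne']
  rw [e1, h, smul_eq_mul, ← integral_const_mul, setIntegral_indicator measurableSet_Ioi,
    Set.inter_eq_right.mpr (Set.Ioi_subset_Ioi (by positivity)), mul_comm δ 2]
  refine setIntegral_congr_fun measurableSet_Ioi (fun u hu => ?_)
  have hu : 2 * δ < u := hu
  have hu0 : 0 < u := by linarith
  have hne : π * δ / u ≠ 0 := by positivity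
  simp only [gg, KK]
  rw [sinc_of_ne_zero hne, show π / (u / δ) = π * δ / u by field_simp,
    show (((2 : ℕ) : ℤ) - 1) = 1 by norm_num, zpow_one]
  field_simp

lemma limit2 (n : ℕ) :
    Tendsto (fun δ => ∫ y in Set.Ioi (2 : ℝ), gg n 2 y * Em 2 (δ * y)) (𝓝[>] 0)
      (𝓝 (∫ u in Set.Ioi (0 : ℝ), π ^ 2 * (Em 2 u / u))) := by
  have : Tendsto (fun δ => ∫ u in Set.Ioi (0 : ℝ), (Set.Ioi (2 * δ)).indicator (fun u => KK n δ u * Em 2 u) u)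
      (𝓝[>] 0) (𝓝 (∫ u in Set.Ioi (0 : ℝ), π ^ 2 * (Em 2 u / u))) := by
    refine tendsto_integral_filter_of_dominated_convergence (fun u => π ^ 2 * exp (-u)) ?_ ?_ ?_ ?_
    · filter_upwards [self_mem_nhdsWithin] with δ hδ
      refine AEStronglyMeasurable.indicator ?_ measurableSet_Ioi
      refine ContinuousOn.aestronglyMeasurable ?_ measurableSet_Ioi
      have h : ContinuousOn (fun u : ℝ => π * δ / u) (Set.Ioi 0) :=
        continuousOn_const.div continuousOn_id (fun y hy => (ne_of_gt hy))
      refine ContinuousOn.mul ?_ continuousOn_Em_two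
      refine (continuousOn_const.div continuousOn_id (fun y hy => (ne_of_gt hy))).mul ?_
      exact ((continuous_cos.comp_continuousOn h).pow n).mul ((continuous_sinc.comp_continuousOn h).pow 2)
    · filter_upwards [self_mem_nhdsWithin] with δ hδ
      refine (ae_restrict_mem measurableSet_Ioi).mono (fun u hu => ?_)
      have hu : 0 < u := hu
      refine (norm_indicator_le_norm_self _ _).trans ?_
      rw [Real.norm_eq_abs]
      unfold KK
      rw [abs_mul, abs_mul, abs_mul, abs_pow, abs_pow, abs_of_pos (by positivity : 0 < π ^ 2 / u)]
      have h1 : |cos (π * δ / u)| ^ n ≤ 1 := pow_le_one₀ (abs_nonneg _) (abs_cos_le_one _)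
      have h2 : |sinc (π * δ / u)| ^ 2 ≤ 1 := pow_le_one₀ (abs_nonneg _) (abs_sinc_le_one _)
      have h12 := mul_le_one₀ h1 (by positivity) h2
      calc _ ≤ π ^ 2 / u * 1 * |Em 2 u| := by gcongr
        _ = π ^ 2 * (|Em 2 u| / u) := by ring
        _ ≤ _ := by gcongr; exact Em_two_abs u hu
    · refine Integrable.const_mul ?_ _
      exact integrableOn_exp_neg_Ioi 0
    · refine (ae_restrict_mem measurableSet_Ioi).mono (fun u hu => ?_)
      have hu : 0 < u := hu
      have hc : Continuous (fun δ => KK n δ u * Em 2 u) := by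
        unfold KK
        have : Continuous (fun δ : ℝ => sinc (π * δ / u)) := continuous_sinc.comp (by fun_prop)
        fun_prop
      have h0 := (hc.tendsto 0).mono_left (nhdsWithin_le_nhds (s := Set.Ioi 0))
      have e : KK n 0 u * Em 2 u = π ^ 2 * (Em 2 u / u) := by
        unfold KK; simp; ring
      rw [e] at h0
      refine h0.congr' ?_
      have hlt : ∀ᶠ δ : ℝ in 𝓝[>] 0, δ < u / 2 :=
        (eventually_lt_nhds (by positivity)).filter_mono nhdsWithin_le_nhds
      filter_upwards [hlt] with δ hδ
      rw [Set.indicator_of_mem]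
      show 2 * δ < u
      linarith
  refine this.congr' ?_
  filter_upwards [self_mem_nhdsWithin] with δ hδ
  exact (limit2_rescale n δ hδ).symm

/-- elementary kernel -/
noncomputable def kk (a b : ℝ) : ℝ := (3 * a ^ 2 - b ^ 2) / (a ^ 2 + b ^ 2) ^ 3

lemma kk_bound (a b : ℝ) (ha : 1 / 2 ≤ a) : |kk a b| ≤ 12 * (a ^ 2)⁻¹ * (1 + b ^ 2)⁻¹ := by
  have ha0 : 0 < a := by linarith
  unfold kk
  rw [abs_div, abs_of_pos (by positivity : 0 < (a ^ 2 + b ^ 2) ^ 3), div_le_iff₀ (by positivity)]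
  have h1 : |3 * a ^ 2 - b ^ 2| ≤ 3 * (a ^ 2 + b ^ 2) := by
    rw [abs_le]; constructor <;> nlinarith [sq_nonneg a, sq_nonneg b]
  refine h1.trans ?_
  have h2 : (1 + b ^ 2) / 4 ≤ a ^ 2 + b ^ 2 := by nlinarith [sq_nonneg b]
  have h3 : a ^ 2 ≤ a ^ 2 + b ^ 2 := by nlinarith [sq_nonneg b]
  have h4 : a ^ 2 * ((1 + b ^ 2) / 4) ≤ (a ^ 2 + b ^ 2) * (a ^ 2 + b ^ 2) :=
    mul_le_mul h3 h2 (by positivity) (by positivity)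
  have e : 12 * (a ^ 2)⁻¹ * (1 + b ^ 2)⁻¹ * (a ^ 2 + b ^ 2) ^ 3 =
     3 * (a ^ 2 + b ^ 2) * (((a ^ 2 + b ^ 2) * (a ^ 2 + b ^ 2)) / (a ^ 2 * ((1 + b ^ 2) / 4))) := by
    field_simp
    ring
  rw [e]
  have h5 : 1 ≤ (((a ^ 2 + b ^ 2) * (a ^ 2 + b ^ 2)) / (a ^ 2 * ((1 + b ^ 2) / 4))) := by
    rw [le_div_iff₀ (by positivity)]; linarith
  have : 0 ≤ 3 * (a ^ 2 + b ^ 2) := by positivity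
  nlinarith

lemma kk_continuous (a : ℝ) (ha : 0 < a) : Continuous (kk a) := by
  unfold kk
  refine Continuous.div (by fun_prop) (by fun_prop) (fun b => by positivity)

lemma kk_integrable (a : ℝ) (ha : 1 / 2 ≤ a) : Integrable (kk a) := by
  refine Integrable.mono' (integrable_inv_one_add_sq.const_mul (12 * (a ^ 2)⁻¹)) (kk_continuous a (by linarith)).aestronglyMeasurable ?_
  exact Eventually.of_forall (fun b => kk_bound a b ha)

lemma kk_integral (a : ℝ) (ha : 1 / 2 ≤ a) : ∫ b in Set.Ioi (0 : ℝ), kk a b = π / 2 * (a ^ 3)⁻¹ := by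
  have ha0 : 0 < a := by linarith
  have hd : ∀ b ∈ Set.Ici (0 : ℝ), HasDerivAt (fun b : ℝ => b / (a ^ 2 + b ^ 2) ^ 2 + (a ^ 2)⁻¹ * (b / (a ^ 2 + b ^ 2))
      + (a ^ 3)⁻¹ * arctan (b / a)) (kk a b) b := by
    intro b _
    have h0 : HasDerivAt (fun b : ℝ => a ^ 2 + b ^ 2) (2 * b) b := by
      simpa using (hasDerivAt_pow 2 b).const_add (a ^ 2)
    have hne : a ^ 2 + b ^ 2 ≠ 0 := by positivity
    have h1 := (hasDerivAt_id b).div (h0.pow 2) (pow_ne_zero 2 hne)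
    have h2 := ((hasDerivAt_id b).div h0 hne).const_mul ((a ^ 2)⁻¹)
    have h3 := (((hasDerivAt_id b).div_const a).arctan).const_mul ((a ^ 3)⁻¹)
    refine ((h1.add h2).add h3).congr_deriv ?_
    unfold kk
    simp only [id, Pi.pow_apply]
    have : 1 + (b / a) ^ 2 = (a ^ 2 + b ^ 2) / a ^ 2 := by field_simp
    rw [this]
    field_simp
    ring
  have ht : Tendsto (fun b : ℝ => b / (a ^ 2 + b ^ 2) ^ 2 + (a ^ 2)⁻¹ * (b / (a ^ 2 + b ^ 2))
      + (a ^ 3)⁻¹ * arctan (b / a)) atTop (𝓝 (0 + (a ^ 2)⁻¹ * 0 + (a ^ 3)⁻¹ * (π / 2))) := by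
    have hinv : Tendsto (fun b : ℝ => b⁻¹) atTop (𝓝 0) := tendsto_inv_atTop_zero
    refine ((?_ : Tendsto _ _ _).add (Tendsto.const_mul _ ?_)).add (Tendsto.const_mul _ ?_)
    · refine squeeze_zero' (g := fun b => (a ^ 2)⁻¹ * b⁻¹) ?_ ?_ (by simpa using hinv.const_mul ((a ^ 2)⁻¹))
      · filter_upwards [eventually_gt_atTop 0] with b hb
        positivity
      · filter_upwards [eventually_gt_atTop 0] with b hb
        rw [div_le_iff₀ (by positivity)]
        have e : (a ^ 2)⁻¹ * b⁻¹ * (a ^ 2 + b ^ 2) ^ 2 = b * ((a ^ 2 + b ^ 2) ^ 2 / (a ^ 2 * b ^ 2)) := by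
          field_simp
        rw [e]
        have : 1 ≤ (a ^ 2 + b ^ 2) ^ 2 / (a ^ 2 * b ^ 2) := by
          rw [le_div_iff₀ (by positivity)]
          nlinarith [sq_nonneg (a ^ 2), sq_nonneg (b ^ 2), mul_pos (pow_pos ha0 2) (pow_pos hb 2)]
        nlinarith
    · refine squeeze_zero' (g := fun b => b⁻¹) ?_ ?_ hinv
      · filter_upwards [eventually_gt_atTop 0] with b hb
        positivity
      · filter_upwards [eventually_gt_atTop 0] with b hb
        rw [div_le_iff₀ (by positivity), inv_mul_eq_div, le_div_iff₀ hb]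
        nlinarith [sq_nonneg a]
    · have h1 : Tendsto (fun b : ℝ => b / a) atTop atTop := tendsto_id.atTop_div_const ha0
      exact (tendsto_arctan_atTop.mono_right nhdsWithin_le_nhds).comp h1
  have h := integral_Ioi_of_hasDerivAt_of_tendsto' hd (kk_integrable a ha).integrableOn ht
  rw [h]
  simp
  ring

lemma Em_two_series (b : ℝ) (hb : 0 < b) :
    Em 2 (2 * π * b) / b = (1 / (2 * π ^ 3)) * ∑' d : ℕ, kk ((d : ℝ) + 1 / 2) b := by
  have hsumk : Summable (fun d : ℕ => kk ((d : ℝ) + 1 / 2) b) := by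
    have hb : ∀ d : ℕ, (1 : ℝ) / 2 ≤ (d : ℝ) + 1 / 2 := fun d => by
      have : (0:ℝ) ≤ d := Nat.cast_nonneg d
      linarith
    have h := (Real.summable_one_div_nat_add_rpow (1 / 2) 2).mpr (by norm_num)
    refine Summable.of_norm_bounded ((h.mul_left 12).mul_right (1 + b ^ 2)⁻¹) (fun d => ?_)
    have h0 : 0 < (d : ℝ) + 1 / 2 := by linarith [hb d]
    rw [abs_of_pos h0, rpow_two, one_div (((d : ℝ) + 1 / 2) ^ 2)]
    exact kk_bound _ b (hb d)
  let z : UpperHalfPlane := ⟨(1 / 2 : ℂ) + b * Complex.I, by simpa using hb⟩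
  have hz : (z : ℂ) = (1 / 2 : ℂ) + b * Complex.I := rfl
  have hq := EisensteinSeries.qExpansion_identity (k := 2) (by norm_num) z
  have hexp : Complex.exp (2 * π * Complex.I * z) = ((-exp (-(2 * π * b)) : ℝ) : ℂ) := by
    rw [hz, show 2 * π * Complex.I * ((1 / 2 : ℂ) + b * Complex.I) = π * Complex.I + (-(2 * π * b) : ℝ) by
      push_cast
      linear_combination (2 * π * b : ℂ) * Complex.I_sq, Complex.exp_add, Complex.exp_pi_mul_I]
    push_cast; ring
  have hq0 : ‖-exp (-(2 * π * b))‖ < 1 := by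
    rw [norm_neg, Real.norm_of_nonneg (exp_pos _).le]
    exact exp_lt_one_iff.mpr (by have : 0 < 2 * π * b := by positivity
                                 linarith)
  have hEm : ∑' n : ℕ, (n : ℝ) ^ 2 * (-exp (-(2 * π * b))) ^ n = - Em 2 (2 * π * b) := by
    have hs := summable_pow_mul_geometric_of_norm_lt_one 2 hq0
    rw [hs.tsum_eq_zero_add]
    unfold Em
    rw [← tsum_neg]
    simp only [Nat.cast_zero, ne_eq, OfNat.ofNat_ne_zero, not_false_eq_true, zero_pow, zero_mul, zero_add]
    refine tsum_congr (fun j => ?_)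
    rw [Em_exp, neg_pow (exp (-(2 * π * b)))]
    push_cast; ring
  have hR : ∑' n : ℕ, (n : ℂ) ^ 2 * Complex.exp (2 * π * Complex.I * z) ^ n = ((- Em 2 (2 * π * b) : ℝ) : ℂ) := by
    rw [hexp, ← hEm, Complex.ofReal_tsum]
    refine tsum_congr (fun j => ?_)
    push_cast; rfl
  rw [hR] at hq
  have him : ∀ n : ℤ, (1 / ((z : ℂ) + n) ^ (2 + 1)).im = -b * kk ((n : ℝ) + 1 / 2) b := by
    intro n
    set a : ℝ := (n : ℝ) + 1 / 2 with ha
    have e0 : (z : ℂ) + n = (a : ℂ) + b * Complex.I := by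
      rw [hz, ha]; push_cast; ring
    have hpos : 0 < a ^ 2 + b ^ 2 := by positivity
    have hne : (a : ℂ) + b * Complex.I ≠ 0 := by
      intro h
      have := congrArg Complex.im h
      simp at this
      exact hb.ne' this
    have hpos' : ((a : ℂ) ^ 2 + b ^ 2) ≠ 0 := by exact_mod_cast hpos.ne'
    have e1 : 1 / ((a : ℂ) + b * Complex.I) ^ (2 + 1) =
        (((a ^ 3 - 3 * a * b ^ 2) / (a ^ 2 + b ^ 2) ^ 3 : ℝ) : ℂ) + ((-b * kk a b : ℝ) : ℂ) * Complex.I := by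
      unfold kk
      rw [div_eq_iff (pow_ne_zero _ hne)]
      push_cast
      field_simp
      have h2 := Complex.I_sq
      have h3 : Complex.I ^ 3 = -Complex.I := by rw [pow_succ, h2]; ring
      have h4 : Complex.I ^ 4 = 1 := by rw [show 4 = 2 * 2 by norm_num, pow_mul, h2]; norm_num
      ring_nf
      simp only [h2, h3, h4]
      ring
    rw [e0, e1, Complex.add_im, Complex.ofReal_im, Complex.im_ofReal_mul, Complex.I_im]
    ring
  have hsumZ : Summable (fun n : ℤ => kk ((n : ℝ) + 1 / 2) b) := by
    refine Summable.of_nat_of_neg_add_one (by simpa using hsumk) ?_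
    refine hsumk.congr (fun d => ?_)
    unfold kk
    push_cast
    ring_nf
  have hZ : ∑' n : ℤ, kk ((n : ℝ) + 1 / 2) b = 2 * ∑' d : ℕ, kk ((d : ℝ) + 1 / 2) b := by
    rw [tsum_of_nat_of_neg_add_one (by simpa using hsumk) (hsumk.congr (fun d => by
      unfold kk
      push_cast
      ring_nf)), two_mul]
    congr 1
    refine tsum_congr (fun d => ?_)
    unfold kk
    push_cast
    ring_nf
  have hsumC : Summable (fun n : ℤ => 1 / ((z : ℂ) + n) ^ (2 + 1)) := by
    have h := EisensteinSeries.linear_right_summable (z : ℂ) 1 (k := 3) (by norm_num)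
    refine h.congr (fun n => ?_)
    rw [one_div]; norm_cast; simp
  have hI := congrArg Complex.im hq
  rw [Complex.im_tsum hsumC, tsum_congr him, tsum_mul_left, hZ] at hI
  have hc : (-2 * (π : ℂ) * Complex.I) ^ (2 + 1) / (Nat.factorial 2 : ℂ) = ((4 * π ^ 3 : ℝ) : ℂ) * Complex.I := by
    have h3 : Complex.I ^ 3 = -Complex.I := by rw [pow_succ, Complex.I_sq]; ring
    rw [mul_pow, show (2 + 1) = 3 by norm_num, h3]
    simp [Nat.factorial]
    ring
  rw [hc, mul_assoc, Complex.im_ofReal_mul, mul_comm Complex.I, Complex.im_ofReal_mul, Complex.I_im] at hI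
  rw [div_eq_iff hb.ne']
  generalize (∑' d : ℕ, kk ((d : ℝ) + 1 / 2) b) = S at hI ⊢
  field_simp
  linarith

lemma zeta_half : ∑' d : ℕ, (((d : ℝ) + 1 / 2) ^ 3)⁻¹ = 7 * zeta3 := by
  have hs : Summable (fun k : ℕ => 1 / ((k : ℝ) + 1) ^ 3) := by
    have h := (summable_nat_add_iff 1).mpr (Real.summable_one_div_nat_pow.mpr (by norm_num : 1 < 3))
    refine h.congr (fun j => ?_)
    push_cast; rfl
  have h1 : Summable (fun k : ℕ => 1 / (((2 * k : ℕ) : ℝ) + 1) ^ 3) :=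
    hs.comp_injective (i := fun k : ℕ => 2 * k) (fun a b h => by simpa using h)
  have h2 : Summable (fun k : ℕ => 1 / (((2 * k + 1 : ℕ) : ℝ) + 1) ^ 3) :=
    hs.comp_injective (i := fun k : ℕ => 2 * k + 1) (fun a b h => by simpa using h)
  have h := tsum_even_add_odd (f := fun k : ℕ => 1 / ((k : ℝ) + 1) ^ 3) h1 h2
  have e1 : ∑' k : ℕ, 1 / (((2 * k : ℕ) : ℝ) + 1) ^ 3 = (1 / 8) * ∑' d : ℕ, (((d : ℝ) + 1 / 2) ^ 3)⁻¹ := by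
    rw [← tsum_mul_left]
    refine tsum_congr (fun k => ?_)
    push_cast
    rw [show (2 * (k : ℝ) + 1) = 2 * (k + 1 / 2) by ring]
    field_simp; norm_num
  have e2 : ∑' k : ℕ, 1 / (((2 * k + 1 : ℕ) : ℝ) + 1) ^ 3 = (1 / 8) * zeta3 := by
    unfold zeta3
    rw [← tsum_mul_left]
    refine tsum_congr (fun k => ?_)
    push_cast
    rw [show (2 * (k : ℝ) + 1 + 1) = 2 * (k + 1) by ring]
    field_simp; norm_num
  have e3 : ∑' k : ℕ, 1 / ((k : ℝ) + 1) ^ 3 = zeta3 := rfl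
  rw [e1, e2, e3] at h
  linarith

lemma Em_two_integral : ∫ u in Set.Ioi (0 : ℝ), Em 2 u / u = 7 * zeta3 / (4 * π ^ 2) := by
  have h := integral_comp_mul_left_Ioi (fun u => Em 2 u / u) 0 (by positivity : 0 < 2 * π)
  rw [mul_zero, smul_eq_mul] at h
  have e1 : ∫ u in Set.Ioi (0 : ℝ), Em 2 u / u = ∫ b in Set.Ioi (0 : ℝ), Em 2 (2 * π * b) / b := by
    have : ∫ u in Set.Ioi (0 : ℝ), Em 2 u / u = 2 * π * ((2 * π)⁻¹ * ∫ u in Set.Ioi (0 : ℝ), Em 2 u / u) := by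
      field_simp
    rw [this, ← h, ← integral_const_mul]
    refine setIntegral_congr_fun measurableSet_Ioi (fun b hb => ?_)
    have hb : 0 < b := hb
    field_simp
  have hb : ∀ d : ℕ, (1 : ℝ) / 2 ≤ (d : ℝ) + 1 / 2 := fun d => by
    have : (0:ℝ) ≤ d := Nat.cast_nonneg d
    linarith
  have hsum : Summable (fun d : ℕ => (((d : ℝ) + 1 / 2) ^ 2)⁻¹) := by
    have h := Real.summable_one_div_nat_add_rpow (1 / 2) 2
    have h := h.mpr (by norm_num)
    refine h.congr (fun d => ?_)
    rw [abs_of_pos (by linarith [hb d]), one_div, rpow_two]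
  have hi : ∀ d : ℕ, Integrable (kk ((d : ℝ) + 1 / 2)) (volume.restrict (Set.Ioi (0:ℝ))) :=
    fun d => (kk_integrable _ (hb d)).integrableOn
  have hn : Summable (fun d : ℕ => ∫ b in Set.Ioi (0 : ℝ), ‖kk ((d : ℝ) + 1 / 2) b‖) := by
    refine Summable.of_nonneg_of_le (fun d => integral_nonneg (fun b => norm_nonneg _)) (fun d => ?_)
      ((hsum.mul_left 12).mul_right (∫ b in Set.Ioi (0 : ℝ), (1 + b ^ 2)⁻¹))
    rw [← integral_const_mul]
    refine integral_mono (hi d).norm ((integrable_inv_one_add_sq.integrableOn).const_mul _) (fun b => ?_)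
    exact kk_bound _ b (hb d)
  have hI := (hasSum_integral_of_summable_integral_norm hi hn).tsum_eq
  rw [e1]
  have e2 : ∫ b in Set.Ioi (0 : ℝ), Em 2 (2 * π * b) / b =
      (1 / (2 * π ^ 3)) * ∫ b in Set.Ioi (0 : ℝ), ∑' d : ℕ, kk ((d : ℝ) + 1 / 2) b := by
    rw [← integral_const_mul]
    exact setIntegral_congr_fun measurableSet_Ioi (fun b hb => Em_two_series b hb)
  rw [e2, ← hI]
  have e3 : ∀ d : ℕ, ∫ b in Set.Ioi (0 : ℝ), kk ((d : ℝ) + 1 / 2) b = π / 2 * (((d : ℝ) + 1 / 2) ^ 3)⁻¹ :=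
    fun d => kk_integral _ (hb d)
  rw [tsum_congr e3, tsum_mul_left, zeta_half]
  field_simp
  ring

lemma ss_two_close : ∃ C : ℝ, 0 < C ∧ ∀ n : ℕ, 26 ≤ n →
    |ss 2 n - 7 / 2 * zeta3| ≤ C * ((n : ℝ) ^ 5)⁻¹ := by
  obtain ⟨C, hC, hb⟩ := ss_close 2
  refine ⟨C, hC, fun n hn => ?_⟩
  have h := hb n _ (by omega) (limit2 n)
  rw [integral_const_mul, Em_two_integral] at h
  convert h using 3
  field_simp
  ring

end

section
open Real MeasureTheory Filter Topology

lemma sin_taylor (x : ℝ) (h0 : 0 ≤ x) (h1 : x ≤ 1) :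
    |sin x - (x - x ^ 3 / 6 + x ^ 5 / 120 - x ^ 7 / 5040)| ≤ x ^ 9 := by
  have hb := Complex.exp_bound (x := (x : ℂ) * Complex.I) (by simp [abs_of_nonneg h0, h1]) (n := 9) (by norm_num)
  have him := (Complex.abs_im_le_norm _).trans hb
  have e1 : (Complex.exp ((x : ℂ) * Complex.I)).im = sin x := Complex.exp_ofReal_mul_I_im x
  have e2 : (∑ m ∈ Finset.range 9, ((x : ℂ) * Complex.I) ^ m / (m.factorial : ℂ)) =
      ((1 - x ^ 2 / 2 + x ^ 4 / 24 - x ^ 6 / 720 + x ^ 8 / 40320 : ℝ) : ℂ) +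
      ((x - x ^ 3 / 6 + x ^ 5 / 120 - x ^ 7 / 5040 : ℝ) : ℂ) * Complex.I := by
    have i2 : Complex.I ^ 2 = -1 := Complex.I_sq
    have i3 : Complex.I ^ 3 = -Complex.I := Complex.I_pow_three
    have i4 : Complex.I ^ 4 = 1 := Complex.I_pow_four
    have i5 : Complex.I ^ 5 = Complex.I := by rw [pow_succ, i4, one_mul]
    have i6 : Complex.I ^ 6 = -1 := by rw [pow_succ, i5, ← sq, i2]
    have i7 : Complex.I ^ 7 = -Complex.I := by rw [pow_succ, i6]; ring
    have i8 : Complex.I ^ 8 = 1 := by rw [pow_succ, i7, neg_mul, ← sq, i2]; ring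
    simp only [Finset.sum_range_succ, Finset.sum_range_zero, mul_pow, i2, i3, i4, i5, i6, i7, i8, Nat.factorial]
    push_cast
    ring
  rw [e2, Complex.sub_im, e1, Complex.add_im, Complex.ofReal_im, Complex.im_ofReal_mul, Complex.I_im] at him
  have e3 : ‖(x : ℂ) * Complex.I‖ = x := by simp [abs_of_nonneg h0]
  rw [e3] at him
  refine (le_trans (by rw [zero_add, mul_one]) him).trans ?_
  have : ((Nat.succ 9 : ℝ) * ((Nat.factorial 9 : ℕ) * ((9 : ℕ) : ℝ))⁻¹) ≤ 1 := by
    norm_num [Nat.factorial]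
  calc x ^ 9 * _ ≤ x ^ 9 * 1 := by
        refine mul_le_mul_of_nonneg_left ?_ (by positivity)
        norm_num [Nat.factorial]
    _ = _ := by ring

/-- the polynomial approximating `sinc` in terms of `sin²` -/
noncomputable def PP (s : ℝ) : ℝ := 1 - s / 6 - 17 / 360 * s ^ 2 - 367 / 15120 * s ^ 3

lemma sinc_alg : ∃ K : ℝ, 0 < K ∧ ∀ t ρ : ℝ, 0 ≤ t → t ≤ 1 → |ρ| ≤ 1 →
    ∀ X : ℝ, X = 1 - t / 6 + t ^ 2 / 120 - t ^ 3 / 5040 + ρ * t ^ 4 →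
    |X - PP (t * X ^ 2)| ≤ K * t ^ 4 := by
  let c : ℝ × ℝ → ℝ := fun p => -1 / 5040 + p.2 * p.1
  let b : ℝ × ℝ → ℝ := fun p => 1 / 120 + p.1 * c p
  let E : ℝ × ℝ → ℝ := fun p => 2 * c p - b p / 3 + p.1 * b p ^ 2
  let y2 : ℝ × ℝ → ℝ := fun p => 2 / 45 + p.1 * E p
  let y1 : ℝ × ℝ → ℝ := fun p => -1 / 3 + p.1 * y2 p
  let Q : ℝ × ℝ → ℝ := fun p => p.2 + E p / 6 + 17 / 360 * (2 * y2 p + y1 p ^ 2) +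
    367 / 15120 * (3 * y1 p + 3 * p.1 * y1 p ^ 2 + p.1 ^ 2 * y1 p ^ 3)
  have hc : Continuous c := by fun_prop
  have hb : Continuous b := by fun_prop
  have hE : Continuous E := by fun_prop
  have hy2 : Continuous y2 := by fun_prop
  have hy1 : Continuous y1 := by fun_prop
  have hQ : Continuous Q := by fun_prop
  obtain ⟨K, hK⟩ := (isCompact_Icc.prod isCompact_Icc : IsCompact (Set.Icc (0:ℝ) 1 ×ˢ Set.Icc (-1 : ℝ) 1)).exists_bound_of_continuousOn hQ.continuousOn
  refine ⟨max K 1, by positivity, fun t ρ h0 h1 hρ X hX => ?_⟩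
  have hm := hK (t, ρ) ⟨⟨h0, h1⟩, abs_le.mp hρ⟩
  have hX1 : X = 1 + t * (-1 / 6 + t * b (t, ρ)) := by rw [hX]; simp only [b, c]; ring
  have hXs : X ^ 2 = 1 + t * y1 (t, ρ) := by
    rw [hX1]
    simp only [y1, y2, E]
    have : b (t, ρ) = 1 / 120 + t * c (t, ρ) := rfl
    have h2 : c (t, ρ) = c (t, ρ) := rfl
    generalize b (t, ρ) = B at *
    generalize c (t, ρ) = D at *
    subst this
    ring
  have key : X - PP (t * X ^ 2) = Q (t, ρ) * t ^ 4 := by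
    rw [hXs, hX]
    have a1 : y1 (t, ρ) = -1 / 3 + t * y2 (t, ρ) := rfl
    have a2 : y2 (t, ρ) = 2 / 45 + t * E (t, ρ) := rfl
    simp only [PP, Q]
    generalize y1 (t, ρ) = u at *
    generalize y2 (t, ρ) = v at *
    generalize E (t, ρ) = e at *
    clear hXs hX1 hm hX
    subst a1; subst a2
    ring
  rw [key, abs_mul, abs_of_nonneg (by positivity : 0 ≤ t ^ 4)]
  gcongr
  exact hm.trans (le_max_left _ _)

lemma sinc_PP : ∃ K : ℝ, 0 < K ∧ ∀ x : ℝ, 0 ≤ x → x ≤ π / 2 →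
    |sinc x - PP (sin x ^ 2)| ≤ K * sin x ^ 8 := by
  obtain ⟨K, hK, h⟩ := sinc_alg
  refine ⟨max (K * 2 ^ 8) (3 * 2 ^ 8), by positivity, fun x h0 hx => ?_⟩
  have hs : x ≤ 2 * sin x := by
    have h2 := mul_le_sin h0 hx
    have h3 : x / 2 ≤ 2 / π * x := by
      rw [div_mul_eq_mul_div, le_div_iff₀ pi_pos]; nlinarith [pi_le_four]
    linarith
  rcases h0.eq_or_lt with rfl | hpos
  · simp [PP]
  rcases le_or_gt x 1 with h1 | h1
  · have ht := sin_taylor x h0 h1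
    have hsx : sinc x = sin x / x := sinc_of_ne_zero hpos.ne'
    set ρ := (sin x - (x - x ^ 3 / 6 + x ^ 5 / 120 - x ^ 7 / 5040)) / x ^ 9 with hρ
    have hρ1 : |ρ| ≤ 1 := by
      rw [hρ, abs_div, abs_of_pos (by positivity : 0 < x ^ 9)]
      exact div_le_one_of_le₀ ht (by positivity)
    have := h (x ^ 2) ρ (by positivity) (by nlinarith) hρ1 (sinc x) (by
      rw [hsx, hρ]; field_simp; ring)
    have e : x ^ 2 * sinc x ^ 2 = sin x ^ 2 := by rw [hsx]; field_simp
    rw [e] at this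
    refine this.trans ?_
    calc K * (x ^ 2) ^ 4 = K * x ^ 8 := by ring
      _ ≤ K * (2 * sin x) ^ 8 := by gcongr
      _ = K * 2 ^ 8 * sin x ^ 8 := by ring
      _ ≤ _ := by
        have : 0 ≤ sin x ^ 8 := by positivity
        gcongr; exact le_max_left _ _
  · have h1s : (1 : ℝ) ≤ 2 * sin x := by linarith
    have e8 : (1 : ℝ) ≤ 2 ^ 8 * sin x ^ 8 := by
      calc (1 : ℝ) ≤ (2 * sin x) ^ 8 := one_le_pow₀ h1s
        _ = _ := by ring
    have hb : |sinc x - PP (sin x ^ 2)| ≤ 3 := by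
      have := abs_le.mp (abs_sinc_le_one x)
      have hs2 : 0 ≤ sin x ^ 2 := by positivity
      have hs3 : sin x ^ 2 ≤ 1 := sin_sq_le_one x
      have q2 : (sin x ^ 2) ^ 2 ≤ 1 := pow_le_one₀ hs2 hs3
      have q3 : (sin x ^ 2) ^ 3 ≤ 1 := pow_le_one₀ hs2 hs3
      have q2' : 0 ≤ (sin x ^ 2) ^ 2 := by positivity
      have q3' : 0 ≤ (sin x ^ 2) ^ 3 := by positivity
      unfold PP
      rw [abs_le]; constructor <;> linarith
    calc _ ≤ (3 : ℝ) := hb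
      _ ≤ 3 * 2 ^ 8 * sin x ^ 8 := by linarith
      _ ≤ _ := by
        have : 0 ≤ sin x ^ 8 := by positivity
        gcongr; exact le_max_right _ _

/-- the polynomial approximating `sinc²` in terms of `sin²` -/
noncomputable def DD (s : ℝ) : ℝ := 1 - s / 3 - s ^ 2 / 15 - 31 / 945 * s ^ 3

lemma sinc_DD : ∃ K : ℝ, 0 < K ∧ ∀ x : ℝ, 0 ≤ x → x ≤ π / 2 →
    |sinc x ^ 2 - DD (sin x ^ 2)| ≤ K * sin x ^ 8 := by
  obtain ⟨K, hK, h⟩ := sinc_PP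
  let Q : ℝ → ℝ := fun s => (17 / 360) ^ 2 + 2 * 367 / (6 * 15120) + 2 * 17 * 367 / (360 * 15120) * s + (367 / 15120) ^ 2 * s ^ 2
  have hPD : ∀ s, PP s ^ 2 - DD s = Q s * s ^ 4 := by
    intro s; simp only [PP, DD, Q]; ring
  refine ⟨K * 4 + 1, by positivity, fun x h0 hx => ?_⟩
  have h1 := h x h0 hx
  have hs2 : 0 ≤ sin x ^ 2 := by positivity
  have hs3 : sin x ^ 2 ≤ 1 := sin_sq_le_one x
  have hs8 : 0 ≤ sin x ^ 8 := by positivity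
  have hP : |PP (sin x ^ 2)| ≤ 3 := by
    have q2 : (sin x ^ 2) ^ 2 ≤ 1 := pow_le_one₀ hs2 hs3
    have q3 : (sin x ^ 2) ^ 3 ≤ 1 := pow_le_one₀ hs2 hs3
    have q2' : 0 ≤ (sin x ^ 2) ^ 2 := by positivity
    have q3' : 0 ≤ (sin x ^ 2) ^ 3 := by positivity
    unfold PP
    rw [abs_le]; constructor <;> linarith
  have hQ : |Q (sin x ^ 2)| ≤ 1 := by
    have q2 : (sin x ^ 2) ^ 2 ≤ 1 := pow_le_one₀ hs2 hs3
    have q2' : 0 ≤ (sin x ^ 2) ^ 2 := by positivity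
    simp only [Q]
    rw [abs_le]; constructor <;> nlinarith
  have e : sinc x ^ 2 - DD (sin x ^ 2) = (sinc x - PP (sin x ^ 2)) * (sinc x + PP (sin x ^ 2)) + Q (sin x ^ 2) * sin x ^ 8 := by
    have := hPD (sin x ^ 2)
    have e8 : (sin x ^ 2) ^ 4 = sin x ^ 8 := by ring
    rw [e8] at this
    linear_combination this
  rw [e]
  calc _ ≤ |(sinc x - PP (sin x ^ 2)) * (sinc x + PP (sin x ^ 2))| + |Q (sin x ^ 2) * sin x ^ 8| := abs_add_le _ _
    _ = |sinc x - PP (sin x ^ 2)| * |sinc x + PP (sin x ^ 2)| + |Q (sin x ^ 2)| * sin x ^ 8 := by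
      rw [abs_mul, abs_mul, abs_of_nonneg hs8]
    _ ≤ (K * sin x ^ 8) * 4 + 1 * sin x ^ 8 := by
      have : |sinc x + PP (sin x ^ 2)| ≤ 4 := by
        refine (abs_add_le _ _).trans ?_
        linarith [abs_sinc_le_one x]
      gcongr
    _ = _ := by ring

end

section
open Real MeasureTheory Filter Topology

lemma gg_subst (n r : ℕ) : ∫ y in Set.Ioi (2 : ℝ), gg n r y =
    ∫ x in (0 : ℝ)..π / 2, (π / x ^ 2) * gg n r (π / x) := by
  have him : Set.image (fun x : ℝ => π / x) (Set.Ioo 0 (π / 2)) = Set.Ioi 2 := by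
    ext y
    simp only [Set.mem_image, Set.mem_Ioo, Set.mem_Ioi]
    constructor
    · rintro ⟨x, ⟨h0, h1⟩, rfl⟩
      rw [lt_div_iff₀ h0]; linarith
    · intro hy
      have hy0 : 0 < y := by linarith
      refine ⟨π / y, ⟨by positivity, ?_⟩, ?_⟩
      · exact div_lt_div_of_pos_left pi_pos (by norm_num) hy
      · field_simp
  have h := integral_image_eq_integral_abs_deriv_smul (s := Set.Ioo 0 (π / 2))
    (f := fun x : ℝ => π / x) (f' := fun x => -(π / x ^ 2)) measurableSet_Ioo
    (fun x hx => by
      have := ((hasDerivAt_inv (ne_of_gt hx.1)).const_mul π).hasDerivWithinAt (s := Set.Ioo 0 (π / 2))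
      have e : -(π / x ^ 2) = π * -(x ^ 2)⁻¹ := by rw [div_eq_mul_inv]; ring
      rw [e]
      simpa only [div_eq_mul_inv] using this)
    (fun x hx y hy hxy => by
      have h1 : x ≠ 0 := ne_of_gt hx.1
      have h2 : y ≠ 0 := ne_of_gt hy.1
      simp only at hxy
      field_simp at hxy
      exact hxy.symm) (gg n r)
  rw [him] at h
  rw [h, intervalIntegral.integral_of_le (by positivity), integral_Ioc_eq_integral_Ioo]
  refine setIntegral_congr_fun measurableSet_Ioo (fun x hx => ?_)
  have hx0 : 0 < x := hx.1
  simp only [smul_eq_mul, abs_neg]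
  rw [abs_of_pos (by positivity)]

lemma gg_subst_zero (n : ℕ) : ∫ y in Set.Ioi (2 : ℝ), gg n 0 y =
    ∫ x in (0 : ℝ)..π / 2, cos x ^ n * sin x * sinc x := by
  rw [gg_subst, intervalIntegral.integral_of_le (by positivity), intervalIntegral.integral_of_le (by positivity)]
  refine setIntegral_congr_fun measurableSet_Ioc (fun x hx => ?_)
  have hx0 : x ≠ 0 := ne_of_gt hx.1
  have hp := pi_ne_zero
  have e : π / (π / x) = x := by field_simp
  have e2 : (π / x) ^ (((0 : ℕ) : ℤ) - 1) = x / π := by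
    rw [show (((0 : ℕ) : ℤ) - 1) = -1 by norm_num, zpow_neg_one, inv_div]
  simp only [gg]
  rw [e, e2, sinc_of_ne_zero hx0]
  field_simp

lemma gg_subst_one (n : ℕ) : ∫ y in Set.Ioi (2 : ℝ), gg n 1 y =
    π * ∫ x in (0 : ℝ)..π / 2, cos x ^ n * sinc x ^ 2 := by
  rw [gg_subst, ← intervalIntegral.integral_const_mul, intervalIntegral.integral_of_le (by positivity),
    intervalIntegral.integral_of_le (by positivity)]
  refine setIntegral_congr_fun measurableSet_Ioc (fun x hx => ?_)
  have hx0 : x ≠ 0 := ne_of_gt hx.1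
  have hp := pi_ne_zero
  have e : π / (π / x) = x := by field_simp
  have e2 : (π / x) ^ (((1 : ℕ) : ℤ) - 1) = 1 := by
    rw [show (((1 : ℕ) : ℤ) - 1) = 0 by norm_num, zpow_zero]
  simp only [gg]
  rw [e, e2, sinc_of_ne_zero hx0]
  field_simp

/-- Wallis-type integrals -/
noncomputable def Iw (n m : ℕ) : ℝ := ∫ x in (0 : ℝ)..π / 2, cos x ^ n * sin x ^ m

lemma Iw_rec (n m : ℕ) : Iw n (m + 2) = (m + 1) / (n + m + 2) * Iw n m := by
  have h := intervalIntegral.integral_eq_sub_of_hasDerivAt (a := 0) (b := π / 2)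
    (f := fun x => cos x ^ (n + 1) * sin x ^ (m + 1))
    (f' := fun x => (m + 1) * (cos x ^ n * sin x ^ m) - (n + m + 2) * (cos x ^ n * sin x ^ (m + 2)))
    (fun x _ => by
      have := ((hasDerivAt_cos x).pow (n + 1)).mul ((hasDerivAt_sin x).pow (m + 1))
      convert! this using 1
      push_cast
      simp only [Pi.pow_apply]
      have := cos_sq x
      have hc : cos x ^ (n + 1) * ((m + 1) * sin x ^ m * cos x) = (m + 1) * cos x ^ n * sin x ^ m * (1 - sin x ^ 2) := by
        rw [← cos_sq']; ring
      rw [hc]; ring)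
    (by apply Continuous.intervalIntegrable; fun_prop)
  rw [intervalIntegral.integral_sub (by apply Continuous.intervalIntegrable; fun_prop)
    (by apply Continuous.intervalIntegrable; fun_prop), intervalIntegral.integral_const_mul,
    intervalIntegral.integral_const_mul] at h
  simp at h
  unfold Iw
  have hne : (n : ℝ) + m + 2 ≠ 0 := by positivity
  field_simp
  linarith

lemma Iw_one (n : ℕ) : Iw n 1 = 1 / (n + 1) := by
  have h := intervalIntegral.integral_eq_sub_of_hasDerivAt (a := 0) (b := π / 2)
    (f := fun x => cos x ^ (n + 1))
    (f' := fun x => -((n + 1) * (cos x ^ n * sin x ^ 1)))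
    (fun x _ => by
      have := ((hasDerivAt_cos x).pow (n + 1))
      convert! this using 1
      push_cast
      ring)
    (by apply Continuous.intervalIntegrable; fun_prop)
  rw [intervalIntegral.integral_neg, intervalIntegral.integral_const_mul] at h
  simp at h
  unfold Iw
  have hne : (n : ℝ) + 1 ≠ 0 := by positivity
  simp only [pow_one]
  field_simp
  linarith

lemma J0_approx : ∃ K : ℝ, 0 < K ∧ ∀ n : ℕ,
    |(∫ x in (0 : ℝ)..π / 2, cos x ^ n * sin x * sinc x) -
      (Iw n 1 - Iw n 3 / 6 - 17 / 360 * Iw n 5 - 367 / 15120 * Iw n 7)| ≤ K * Iw n 9 := by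
  obtain ⟨K, hK, h⟩ := sinc_PP
  refine ⟨K, hK, fun n => ?_⟩
  have hi : ∀ m : ℕ, IntervalIntegrable (fun x => cos x ^ n * sin x ^ m) volume 0 (π / 2) :=
    fun m => by apply Continuous.intervalIntegrable; fun_prop
  have e : Iw n 1 - Iw n 3 / 6 - 17 / 360 * Iw n 5 - 367 / 15120 * Iw n 7 =
      ∫ x in (0 : ℝ)..π / 2, cos x ^ n * sin x * PP (sin x ^ 2) := by
    unfold Iw
    rw [← intervalIntegral.integral_div, ← intervalIntegral.integral_const_mul,
      ← intervalIntegral.integral_const_mul, ← intervalIntegral.integral_sub (hi _) ((hi _).div_const _),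
      ← intervalIntegral.integral_sub ((hi _).sub ((hi _).div_const _)) ((hi _).const_mul _),
      ← intervalIntegral.integral_sub (((hi _).sub ((hi _).div_const _)).sub ((hi _).const_mul _)) ((hi _).const_mul _)]
    refine intervalIntegral.integral_congr (fun x _ => ?_)
    simp only [PP]; ring
  have hcs := continuous_sinc
  have hcP : Continuous PP := by unfold PP; fun_prop
  rw [e, ← intervalIntegral.integral_sub (by apply Continuous.intervalIntegrable; fun_prop)
    (by apply Continuous.intervalIntegrable; fun_prop), ← Real.norm_eq_abs, Iw, ← intervalIntegral.integral_const_mul]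
  refine intervalIntegral.norm_integral_le_of_norm_le (by positivity) (ae_of_all _ fun x hx => ?_)
    ((hi 9).const_mul K)
  have hs : 0 ≤ sin x := sin_nonneg_of_nonneg_of_le_pi hx.1.le (by linarith [hx.2, pi_pos])
  have hc : 0 ≤ cos x := cos_nonneg_of_neg_pi_div_two_le_of_le (by linarith [hx.1, pi_pos]) hx.2
  rw [← mul_sub, Real.norm_eq_abs, abs_mul, abs_of_nonneg (by positivity)]
  calc _ ≤ cos x ^ n * sin x * (K * sin x ^ 8) := by gcongr; exact h x hx.1.le hx.2
    _ = _ := by ring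

lemma J1_approx : ∃ K : ℝ, 0 < K ∧ ∀ n : ℕ,
    |(∫ x in (0 : ℝ)..π / 2, cos x ^ n * sinc x ^ 2) -
      (Iw n 0 - Iw n 2 / 3 - 1 / 15 * Iw n 4 - 31 / 945 * Iw n 6)| ≤ K * Iw n 8 := by
  obtain ⟨K, hK, h⟩ := sinc_DD
  refine ⟨K, hK, fun n => ?_⟩
  have hi : ∀ m : ℕ, IntervalIntegrable (fun x => cos x ^ n * sin x ^ m) volume 0 (π / 2) :=
    fun m => by apply Continuous.intervalIntegrable; fun_prop
  have e : Iw n 0 - Iw n 2 / 3 - 1 / 15 * Iw n 4 - 31 / 945 * Iw n 6 =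
      ∫ x in (0 : ℝ)..π / 2, cos x ^ n * DD (sin x ^ 2) := by
    unfold Iw
    rw [← intervalIntegral.integral_div, ← intervalIntegral.integral_const_mul,
      ← intervalIntegral.integral_const_mul, ← intervalIntegral.integral_sub (hi _) ((hi _).div_const _),
      ← intervalIntegral.integral_sub ((hi _).sub ((hi _).div_const _)) ((hi _).const_mul _),
      ← intervalIntegral.integral_sub (((hi _).sub ((hi _).div_const _)).sub ((hi _).const_mul _)) ((hi _).const_mul _)]
    refine intervalIntegral.integral_congr (fun x _ => ?_)
    simp only [DD]; ring
  have hcs := continuous_sinc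
  have hcP : Continuous DD := by unfold DD; fun_prop
  rw [e, ← intervalIntegral.integral_sub (by apply Continuous.intervalIntegrable; fun_prop)
    (by apply Continuous.intervalIntegrable; fun_prop), ← Real.norm_eq_abs, Iw, ← intervalIntegral.integral_const_mul]
  refine intervalIntegral.norm_integral_le_of_norm_le (by positivity) (ae_of_all _ fun x hx => ?_)
    ((hi 8).const_mul K)
  have hs : 0 ≤ sin x := sin_nonneg_of_nonneg_of_le_pi hx.1.le (by linarith [hx.2, pi_pos])
  have hc : 0 ≤ cos x := cos_nonneg_of_neg_pi_div_two_le_of_le (by linarith [hx.1, pi_pos]) hx.2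
  rw [← mul_sub, Real.norm_eq_abs, abs_mul, abs_of_nonneg (by positivity)]
  calc _ ≤ cos x ^ n * (K * sin x ^ 8) := by gcongr; exact h x hx.1.le hx.2
    _ = _ := by ring

/-! ### Wallis -/

lemma Iw_nonneg (n m : ℕ) : 0 ≤ Iw n m := by
  refine intervalIntegral.integral_nonneg (by positivity) (fun x hx => ?_)
  have hs : 0 ≤ sin x := sin_nonneg_of_nonneg_of_le_pi hx.1 (by linarith [hx.2, pi_pos])
  have hc : 0 ≤ cos x := cos_nonneg_of_neg_pi_div_two_le_of_le (by linarith [hx.1, pi_pos]) hx.2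
  positivity

/-- the Wallis integral -/
noncomputable def wn (n : ℕ) : ℝ := Iw n 0

lemma wn_eq (n : ℕ) : wn n = ∫ x in (0 : ℝ)..π / 2, cos x ^ n := by simp [wn, Iw]

lemma wn_pos (n : ℕ) : 0 < wn n := by rw [wn_eq]; exact EulerSine.integral_cos_pow_pos n

lemma wn_rec (n : ℕ) : wn (n + 2) = (n + 1) / (n + 2) * wn n := by
  rw [wn_eq, wn_eq, integral_cos_pow]; simp

lemma wn_anti (n : ℕ) : wn (n + 1) ≤ wn n := by
  rw [wn_eq, wn_eq, EulerSine.integral_cos_pow_eq, EulerSine.integral_cos_pow_eq]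
  have := integral_sin_pow_antitone (Nat.le_succ n)
  simp only at this
  linarith

lemma wn_prod (n : ℕ) : wn n * wn (n + 1) = π / (2 * (n + 1)) := by
  induction n with
  | zero => simp [wn_eq]
  | succ k ih =>
    rw [wn_rec]
    have : wn (k + 1) * ((k + 1) / (k + 2) * wn k) = (k + 1) / (k + 2) * (wn k * wn (k + 1)) := by ring
    rw [this, ih]; push_cast; field_simp; ring

lemma wn_sq_lower (n : ℕ) : π / (2 * (n + 1)) ≤ wn n ^ 2 := by
  rw [← wn_prod, sq]; exact mul_le_mul_of_nonneg_left (wn_anti n) (wn_pos n).le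

lemma wn_sq_upper (n : ℕ) (hn : 1 ≤ n) : wn n ^ 2 ≤ π / (2 * n) := by
  obtain ⟨k, rfl⟩ := Nat.exists_eq_add_of_le' hn
  push_cast
  rw [← wn_prod, sq]; exact mul_le_mul_of_nonneg_right (wn_anti k) (wn_pos _).le

lemma wn_sq_rec (n : ℕ) : wn (n + 2) ^ 2 = ((n + 1) / (n + 2)) ^ 2 * wn n ^ 2 := by
  rw [wn_rec]; ring

end

section
open Real MeasureTheory Filter Topology Asymptotics

lemma wn_sq_lim : Tendsto (fun n : ℕ => wn n ^ 2 * (n : ℝ)) atTop (𝓝 (π / 2)) := by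
  have h1 : Tendsto (fun n : ℕ => π / 2 * ((n : ℝ) / ((n : ℝ) + 1))) atTop (𝓝 (π / 2)) := by
    have := (tendsto_natCast_div_add_atTop (1 : ℝ)).const_mul (π / 2)
    simpa using this
  refine tendsto_of_tendsto_of_tendsto_of_le_of_le' h1 tendsto_const_nhds ?_ ?_
  · filter_upwards with n
    have := wn_sq_lower n
    calc _ = π / (2 * (n + 1)) * n := by field_simp
      _ ≤ _ := by gcongr
  · filter_upwards [eventually_ge_atTop 1] with n hn
    have := wn_sq_upper n hn
    have hn' : (0 : ℝ) < n := by exact_mod_cast hn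
    calc _ ≤ π / (2 * n) * n := by gcongr
      _ = _ := by field_simp

lemma nu_lim : Tendsto (fun n : ℕ => ((n : ℝ))⁻¹) atTop (𝓝 0) := tendsto_inv_atTop_nhds_zero_nat

noncomputable def pU (x : ℝ) : ℝ := x ^ 3 - x ^ 2 / 2 + x / 8 + 1 / 16
noncomputable def qL (x : ℝ) : ℝ := x ^ 4 - x ^ 3 / 2 + x ^ 2 / 8 + x / 16 - 1

lemma pU_pos (x : ℝ) (hx : 1 ≤ x) : 0 < pU x := by
  unfold pU; nlinarith [mul_nonneg (sq_nonneg x) (sub_nonneg.mpr hx)]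

lemma qL_pos (x : ℝ) (hx : 2 ≤ x) : 0 < qL x := by
  obtain ⟨y, hy, rfl⟩ : ∃ y, 0 ≤ y ∧ x = y + 2 := ⟨x - 2, by linarith, by ring⟩
  unfold qL
  have : (y + 2) ^ 4 - (y + 2) ^ 3 / 2 + (y + 2) ^ 2 / 8 + (y + 2) / 16 - 1 =
    y ^ 4 + (15 / 2) * y ^ 3 + (169 / 8) * y ^ 2 + (425 / 16) * y + 93 / 8 := by ring
  rw [this]; positivity

lemma lim_unique_mono (R : ℕ → ℝ) (L : ℝ) (N : ℕ) (hlim : Tendsto R atTop (𝓝 L))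
    (hstep : ∀ n, N ≤ n → R n ≤ R (n + 2)) : ∀ n, N ≤ n → R n ≤ L := by
  intro n hn
  have hm : Monotone (fun k : ℕ => R (n + 2 * k)) :=
    monotone_nat_of_le_succ (fun k => hstep (n + 2 * k) (by omega))
  have ht : Tendsto (fun k : ℕ => n + 2 * k) atTop atTop :=
    tendsto_atTop_mono (fun k => by simp only [id]; omega) tendsto_id
  have := hm.ge_of_tendsto (hlim.comp ht) 0
  simpa using this

lemma wn_sq_le (n : ℕ) (hn : 1 ≤ n) : wn n ^ 2 ≤ π / 2 * (pU n / (n : ℝ) ^ 4) := by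
  set R : ℕ → ℝ := fun n => wn n ^ 2 * ((n : ℝ) ^ 4 / pU n) with hR
  have hlim : Tendsto R atTop (𝓝 (π / 2)) := by
    have h2 : Tendsto (fun n : ℕ => 1 - (n : ℝ)⁻¹ / 2 + (n : ℝ)⁻¹ ^ 2 / 8 + (n : ℝ)⁻¹ ^ 3 / 16) atTop (𝓝 1) := by
      have : Continuous (fun y : ℝ => 1 - y / 2 + y ^ 2 / 8 + y ^ 3 / 16) := by fun_prop
      have := (this.tendsto 0).comp nu_lim
      simpa [Function.comp_def] using this
    have h3 := wn_sq_lim.div h2 one_ne_zero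
    rw [div_one] at h3
    refine h3.congr' ?_
    filter_upwards [eventually_ge_atTop 1] with n hn
    have h1 : (1 : ℝ) ≤ n := by exact_mod_cast hn
    have hp := pU_pos n h1
    have e : 1 - (n : ℝ)⁻¹ / 2 + (n : ℝ)⁻¹ ^ 2 / 8 + (n : ℝ)⁻¹ ^ 3 / 16 = pU n / (n : ℝ) ^ 3 := by
      unfold pU; field_simp
    simp only [Pi.div_apply, hR]
    rw [e]; field_simp
  have := lim_unique_mono R (π / 2) 1 hlim (fun m hm => by
    have h1 : (1 : ℝ) ≤ m := by exact_mod_cast hm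
    have hp := pU_pos m h1
    have hp2 := pU_pos (m + 2) (by linarith)
    simp only [hR]
    rw [wn_sq_rec]
    push_cast
    have hk : (m : ℝ) ^ 4 / pU m ≤ (m + 1) ^ 2 * (m + 2) ^ 2 / pU (m + 2) := by
      rw [div_le_div_iff₀ hp hp2]
      have : (m + 1) ^ 2 * (m + 2) ^ 2 * pU m - (m : ℝ) ^ 4 * pU (m + 2) = 1 / 4 + 5 / 4 * m + 5 / 16 * (m : ℝ) ^ 2 := by
        unfold pU; ring
      have h0 : 0 ≤ 1 / 4 + 5 / 4 * (m : ℝ) + 5 / 16 * (m : ℝ) ^ 2 := by positivity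
      linarith
    calc wn m ^ 2 * ((m : ℝ) ^ 4 / pU m) ≤ wn m ^ 2 * ((m + 1) ^ 2 * (m + 2) ^ 2 / pU (m + 2)) := by gcongr
      _ = _ := by field_simp) n hn
  have h1 : (1 : ℝ) ≤ n := by exact_mod_cast hn
  have hp := pU_pos n h1
  simp only [hR] at this
  rw [← mul_div_assoc, div_le_iff₀ hp] at this
  rw [← mul_div_assoc, le_div_iff₀ (by positivity)]
  exact this

lemma wn_sq_ge (n : ℕ) (hn : 2 ≤ n) : π / 2 * (qL n / (n : ℝ) ^ 5) ≤ wn n ^ 2 := by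
  set R : ℕ → ℝ := fun n => -(wn n ^ 2 * ((n : ℝ) ^ 5 / qL n)) with hR
  have hlim : Tendsto R atTop (𝓝 (-(π / 2))) := by
    have h2 : Tendsto (fun n : ℕ => 1 - (n : ℝ)⁻¹ / 2 + (n : ℝ)⁻¹ ^ 2 / 8 + (n : ℝ)⁻¹ ^ 3 / 16 - (n : ℝ)⁻¹ ^ 4) atTop (𝓝 1) := by
      have : Continuous (fun y : ℝ => 1 - y / 2 + y ^ 2 / 8 + y ^ 3 / 16 - y ^ 4) := by fun_prop
      have := (this.tendsto 0).comp nu_lim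
      simpa [Function.comp_def] using this
    have h3 := (wn_sq_lim.div h2 one_ne_zero).neg
    rw [div_one] at h3
    refine h3.congr' ?_
    filter_upwards [eventually_ge_atTop 2] with n hn
    have h1 : (2 : ℝ) ≤ n := by exact_mod_cast hn
    have h0 : (0 : ℝ) < n := by linarith
    have hp := qL_pos n h1
    have e : 1 - (n : ℝ)⁻¹ / 2 + (n : ℝ)⁻¹ ^ 2 / 8 + (n : ℝ)⁻¹ ^ 3 / 16 - (n : ℝ)⁻¹ ^ 4 = qL n / (n : ℝ) ^ 4 := by
      unfold qL; field_simp
    simp only [Pi.div_apply, hR]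
    rw [e]; field_simp
  have := lim_unique_mono R (-(π / 2)) 2 hlim (fun m hm => by
    have h1 : (2 : ℝ) ≤ m := by exact_mod_cast hm
    have hp := qL_pos m h1
    have hp2 := qL_pos (m + 2) (by linarith)
    simp only [hR]
    rw [wn_sq_rec]
    push_cast
    have hk : (m + 1) ^ 2 * (m + 2) ^ 3 / qL (m + 2) ≤ (m : ℝ) ^ 5 / qL m := by
      rw [div_le_div_iff₀ hp2 hp]
      obtain ⟨y, hy, hxy⟩ : ∃ y : ℝ, 0 ≤ y ∧ (m : ℝ) = y + 2 := ⟨m - 2, by linarith, by ring⟩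
      rw [hxy]
      have : (y + 2) ^ 5 * qL (y + 2 + 2) - (y + 2 + 1) ^ 2 * (y + 2 + 2) ^ 3 * qL (y + 2) =
        512 + 692 * y + 717 / 2 * y ^ 2 + 677 / 8 * y ^ 3 + 123 / 16 * y ^ 4 := by
        unfold qL; ring
      have h0 : 0 ≤ 512 + 692 * y + 717 / 2 * y ^ 2 + 677 / 8 * y ^ 3 + 123 / 16 * y ^ 4 := by positivity
      linarith
    have : ((m + 1) / (m + 2) : ℝ) ^ 2 * wn m ^ 2 * ((m + 2) ^ 5 / qL (m + 2)) =
      wn m ^ 2 * ((m + 1) ^ 2 * (m + 2) ^ 3 / qL (m + 2)) := by field_simp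
    rw [this]
    apply neg_le_neg
    gcongr) n hn
  have h1 : (2 : ℝ) ≤ n := by exact_mod_cast hn
  have hp := qL_pos n h1
  have h0 : (0 : ℝ) < n := by linarith
  simp only [hR] at this
  rw [neg_le_neg_iff, ← mul_div_assoc, le_div_iff₀ hp] at this
  rw [← mul_div_assoc, div_le_iff₀ (by positivity)]
  exact this

/-- `1 / n` -/
noncomputable def nu (n : ℕ) : ℝ := (n : ℝ)⁻¹

lemma nu_le (n : ℕ) : nu n ≤ 1 := by unfold nu; exact Nat.cast_inv_le_one n
lemma nu_nonneg (n : ℕ) : 0 ≤ nu n := by unfold nu; positivity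

lemma isBigO_nu {f : ℕ → ℝ} {C : ℝ} {k N : ℕ} (h : ∀ n, N ≤ n → |f n| ≤ C * nu n ^ k) :
    f =O[atTop] (fun n => nu n ^ k) := by
  refine IsBigO.of_bound C ?_
  filter_upwards [eventually_ge_atTop N] with n hn
  rw [Real.norm_eq_abs, Real.norm_of_nonneg (pow_nonneg (nu_nonneg n) k)]
  exact h n hn

/-- `w_n² = (π/2) ν (V(ν) + η)` -/
lemma wn_sq_asymp : ∃ η : ℕ → ℝ, η =O[atTop] (fun n => nu n ^ 4) ∧ ∀ n, 2 ≤ n →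
    wn n ^ 2 = π / 2 * nu n * (1 - nu n / 2 + nu n ^ 2 / 8 + nu n ^ 3 / 16 + η n) := by
  refine ⟨fun n => wn n ^ 2 / (π / 2 * nu n) - (1 - nu n / 2 + nu n ^ 2 / 8 + nu n ^ 3 / 16), ?_, ?_⟩
  · refine isBigO_nu (C := 1) (N := 2) (fun n hn => ?_)
    have hn' : (2 : ℝ) ≤ n := by exact_mod_cast hn
    have h0 : (0 : ℝ) < n := by linarith
    have h1 := wn_sq_le n (by omega)
    have h2 := wn_sq_ge n hn
    have e : wn n ^ 2 / (π / 2 * nu n) = wn n ^ 2 * n / (π / 2) := by unfold nu; field_simp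
    have hpi := pi_pos
    have a1 : wn n ^ 2 / (π / 2 * nu n) ≤ pU n / n ^ 3 := by
      rw [e, div_le_iff₀ (by positivity)]
      calc _ ≤ π / 2 * (pU n / (n : ℝ) ^ 4) * n := by gcongr
        _ = _ := by field_simp
    have a2 : qL n / n ^ 4 ≤ wn n ^ 2 / (π / 2 * nu n) := by
      rw [e, le_div_iff₀ (by positivity)]
      calc _ = π / 2 * (qL n / (n : ℝ) ^ 5) * n := by field_simp
        _ ≤ _ := by gcongr
    have b1 : pU n / n ^ 3 = 1 - nu n / 2 + nu n ^ 2 / 8 + nu n ^ 3 / 16 := by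
      unfold pU nu; field_simp
    have b2 : qL n / n ^ 4 = 1 - nu n / 2 + nu n ^ 2 / 8 + nu n ^ 3 / 16 - nu n ^ 4 := by
      unfold qL nu; field_simp
    rw [b1] at a1; rw [b2] at a2
    have h4 : 0 ≤ nu n ^ 4 := pow_nonneg (nu_nonneg n) 4
    rw [abs_le]; constructor <;> linarith
  · intro n hn
    have h0 : (0 : ℝ) < n := by exact_mod_cast (by omega : 0 < n)
    have hnu : nu n ≠ 0 := by unfold nu; positivity
    have hpi := pi_ne_zero
    field_simp
    ring

lemma J0_asymp : ∃ e : ℕ → ℝ, e =O[atTop] (fun n => nu n ^ 5) ∧ ∀ n, 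
    (∫ x in (0 : ℝ)..π / 2, cos x ^ n * sin x * sinc x) =
      nu n * (1 - 4 / 3 * nu n + 88 / 45 * nu n ^ 2 - 976 / 315 * nu n ^ 3) + e n := by
  obtain ⟨K, hK, h⟩ := J0_approx
  refine ⟨fun n => (∫ x in (0 : ℝ)..π / 2, cos x ^ n * sin x * sinc x) -
      nu n * (1 - 4 / 3 * nu n + 88 / 45 * nu n ^ 2 - 976 / 315 * nu n ^ 3), ?_, fun n => by ring⟩
  refine isBigO_nu (C := K * 384 + 1000) (N := 1) (fun n hn => ?_)
  have h1 : (1 : ℝ) ≤ n := by exact_mod_cast hn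
  have h0 : (0 : ℝ) < n := by linarith
  have i1 := Iw_one n
  have i3 := Iw_rec n 1
  have i5 := Iw_rec n 3
  have i7 := Iw_rec n 5
  have i9 := Iw_rec n 7
  norm_num at i3 i5 i7 i9
  rw [i1] at i3; rw [i3] at i5; rw [i5] at i7; rw [i7] at i9
  have b9 : Iw n 9 ≤ 384 * nu n ^ 5 := by
    rw [i9]
    have e : (384 : ℝ) * nu n ^ 5 = 8 / n * (6 / n * (4 / n * (2 / n * (1 / n)))) := by
      unfold nu; field_simp; norm_num
    rw [e]
    gcongr <;> linarith
  have main : Iw n 1 - Iw n 3 / 6 - 17 / 360 * Iw n 5 - 367 / 15120 * Iw n 7 -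
      nu n * (1 - 4 / 3 * nu n + 88 / 45 * nu n ^ 2 - 976 / 315 * nu n ^ 3) =
      (976 / 3 + 107096 / 315 * n + 436 / 7 * (n : ℝ) ^ 2 + 697 / 63 * (n : ℝ) ^ 3) /
        ((n : ℝ) ^ 4 * ((n + 1) * (n + 3) * (n + 5) * (n + 7))) := by
    rw [i7, i5, i3, i1]
    have q1 : (n : ℝ) + 1 + 2 = n + 3 := by ring
    have q2 : (n : ℝ) + 3 + 2 = n + 5 := by ring
    have q3 : (n : ℝ) + 5 + 2 = n + 7 := by ring
    rw [q1, q2, q3]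
    unfold nu
    field_simp
    ring
  have hb : |Iw n 1 - Iw n 3 / 6 - 17 / 360 * Iw n 5 - 367 / 15120 * Iw n 7 -
      nu n * (1 - 4 / 3 * nu n + 88 / 45 * nu n ^ 2 - 976 / 315 * nu n ^ 3)| ≤ 1000 * nu n ^ 5 := by
    rw [main, abs_of_nonneg (by positivity)]
    have g2 : (n : ℝ) ≤ n ^ 3 := le_self_pow₀ h1 (by norm_num)
    have g3 : (n : ℝ) ^ 2 ≤ n ^ 3 := pow_le_pow_right₀ h1 (by norm_num)
    have g4 : (1 : ℝ) ≤ n ^ 3 := one_le_pow₀ h1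
    calc _ ≤ (1000 * (n : ℝ) ^ 3) / ((n : ℝ) ^ 4 * (n * n * n * n)) := by
          gcongr <;> linarith
      _ = _ := by unfold nu; field_simp
  have h2 := h n
  have h3 : K * Iw n 9 ≤ K * (384 * nu n ^ 5) := by gcongr
  calc _ = |((∫ x in (0 : ℝ)..π / 2, cos x ^ n * sin x * sinc x) -
      (Iw n 1 - Iw n 3 / 6 - 17 / 360 * Iw n 5 - 367 / 15120 * Iw n 7)) +
      (Iw n 1 - Iw n 3 / 6 - 17 / 360 * Iw n 5 - 367 / 15120 * Iw n 7 -
      nu n * (1 - 4 / 3 * nu n + 88 / 45 * nu n ^ 2 - 976 / 315 * nu n ^ 3))| := by ring_nf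
    _ ≤ _ := abs_add_le _ _
    _ ≤ _ := by linarith

lemma J1_asymp : ∃ δ : ℕ → ℝ, δ =O[atTop] (fun n => nu n ^ 4) ∧ ∀ n,
    (∫ x in (0 : ℝ)..π / 2, cos x ^ n * sinc x ^ 2) =
      wn n * (1 - nu n / 3 + 7 / 15 * nu n ^ 2 - 197 / 315 * nu n ^ 3 + δ n) := by
  obtain ⟨K, hK, h⟩ := J1_approx
  refine ⟨fun n => (∫ x in (0 : ℝ)..π / 2, cos x ^ n * sinc x ^ 2) / wn n -
      (1 - nu n / 3 + 7 / 15 * nu n ^ 2 - 197 / 315 * nu n ^ 3), ?_, fun n => by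
        have := (wn_pos n).ne'
        field_simp; ring⟩
  refine isBigO_nu (C := K * 105 + 1000) (N := 1) (fun n hn => ?_)
  have h1 : (1 : ℝ) ≤ n := by exact_mod_cast hn
  have h0 : (0 : ℝ) < n := by linarith
  have hw := wn_pos n
  have i1 : Iw n 0 = wn n := rfl
  have i3 := Iw_rec n 0
  have i5 := Iw_rec n 2
  have i7 := Iw_rec n 4
  have i9 := Iw_rec n 6
  norm_num at i3 i5 i7 i9
  rw [i1] at i3; rw [i3] at i5; rw [i5] at i7; rw [i7] at i9
  have b9 : Iw n 8 ≤ 105 * nu n ^ 4 * wn n := by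
    rw [i9]
    have e : 105 * nu n ^ 4 * wn n = 7 / n * (5 / n * (3 / n * (1 / n * wn n))) := by
      unfold nu; field_simp; norm_num
    rw [e, ← one_div]
    gcongr <;> linarith
  have main : Iw n 0 - Iw n 2 / 3 - 1 / 15 * Iw n 4 - 31 / 945 * Iw n 6 -
      wn n * (1 - nu n / 3 + 7 / 15 * nu n ^ 2 - 197 / 315 * nu n ^ 3) =
      wn n * ((3152 / 105 + 1612 / 315 * n + 104 / 35 * (n : ℝ) ^ 2) /
        ((n : ℝ) ^ 3 * ((n + 2) * (n + 4) * (n + 6)))) := by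
    rw [i7, i5, i3, i1]
    have q2 : (n : ℝ) + 2 + 2 = n + 4 := by ring
    have q3 : (n : ℝ) + 4 + 2 = n + 6 := by ring
    rw [q2, q3]
    unfold nu
    field_simp
    ring
  have hb : |Iw n 0 - Iw n 2 / 3 - 1 / 15 * Iw n 4 - 31 / 945 * Iw n 6 -
      wn n * (1 - nu n / 3 + 7 / 15 * nu n ^ 2 - 197 / 315 * nu n ^ 3)| ≤ wn n * (1000 * nu n ^ 4) := by
    rw [main, abs_of_nonneg (by positivity)]
    have g2 : (n : ℝ) ≤ n ^ 2 := le_self_pow₀ h1 (by norm_num)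
    have g4 : (1 : ℝ) ≤ n ^ 2 := one_le_pow₀ h1
    calc _ ≤ wn n * ((1000 * (n : ℝ) ^ 2) / ((n : ℝ) ^ 3 * (n * n * n))) := by
          gcongr <;> linarith
      _ = _ := by unfold nu; field_simp
  have h2 := h n
  have h3 : K * Iw n 8 ≤ K * (105 * nu n ^ 4 * wn n) := by gcongr
  have e : (∫ x in (0 : ℝ)..π / 2, cos x ^ n * sinc x ^ 2) / wn n -
      (1 - nu n / 3 + 7 / 15 * nu n ^ 2 - 197 / 315 * nu n ^ 3) = 
      (((∫ x in (0 : ℝ)..π / 2, cos x ^ n * sinc x ^ 2) -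
      (Iw n 0 - Iw n 2 / 3 - 1 / 15 * Iw n 4 - 31 / 945 * Iw n 6)) +
      (Iw n 0 - Iw n 2 / 3 - 1 / 15 * Iw n 4 - 31 / 945 * Iw n 6 -
      wn n * (1 - nu n / 3 + 7 / 15 * nu n ^ 2 - 197 / 315 * nu n ^ 3))) / wn n := by
    field_simp; ring
  rw [e, abs_div, abs_of_pos hw, div_le_iff₀ hw]
  refine (abs_add_le _ _).trans ?_
  linarith

end

section
open Real MeasureTheory Filter Topology Asymptotics

lemma nuO_mono {f : ℕ → ℝ} {a b : ℕ} (h : f =O[atTop] (fun n => nu n ^ b)) (hab : a ≤ b) :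
    f =O[atTop] (fun n => nu n ^ a) := by
  refine h.trans (isBigO_nu (C := 1) (N := 0) (fun n _ => ?_))
  rw [abs_of_nonneg (pow_nonneg (nu_nonneg n) b), one_mul]
  exact pow_le_pow_of_le_one (nu_nonneg n) (nu_le n) hab

lemma nuO_mul {f g : ℕ → ℝ} {a b : ℕ} (c : ℕ) (hf : f =O[atTop] (fun n => nu n ^ a))
    (hg : g =O[atTop] (fun n => nu n ^ b)) (hc : c ≤ a + b) :
    (fun n => f n * g n) =O[atTop] (fun n => nu n ^ c) := by
  have := hf.mul hg
  simp only [← pow_add] at this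
  exact nuO_mono this hc

lemma nuO_cont {Q : ℝ → ℝ} (hQ : Continuous Q) : (fun n => Q (nu n)) =O[atTop] (fun n => nu n ^ 0) := by
  obtain ⟨K, hK⟩ := (isCompact_Icc : IsCompact (Set.Icc (0:ℝ) 1)).exists_bound_of_continuousOn hQ.continuousOn
  refine isBigO_nu (C := K) (N := 0) (fun n _ => ?_)
  simpa using hK (nu n) ⟨nu_nonneg n, nu_le n⟩

lemma nuO_pow (k : ℕ) : (fun n => nu n ^ k) =O[atTop] (fun n => nu n ^ k) := isBigO_refl _ _

/-- polynomials -/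
noncomputable def pa (y : ℝ) : ℝ := 1 - 4 / 3 * y + 88 / 45 * y ^ 2 - 976 / 315 * y ^ 3
noncomputable def pb (y : ℝ) : ℝ := 1 - 7 / 6 * y + 541 / 360 * y ^ 2 - 10609 / 5040 * y ^ 3
noncomputable def pV (y : ℝ) : ℝ := 1 - y / 2 + y ^ 2 / 8 + y ^ 3 / 16
noncomputable def pB (y : ℝ) : ℝ := 1 - y / 3 + 7 / 15 * y ^ 2 - 197 / 315 * y ^ 3

lemma ss_zero_asymp : ∃ e : ℕ → ℝ, e =O[atTop] (fun n => nu n ^ 5) ∧ ∀ n,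
    ss 0 n = nu n * pa (nu n) + e n := by
  obtain ⟨C, hC, h⟩ := ss_zero_close
  obtain ⟨e, he, h2⟩ := J0_asymp
  refine ⟨fun n => (ss 0 n - ∫ y in Set.Ioi (2:ℝ), gg n 0 y) + e n, ?_, fun n => ?_⟩
  · refine IsBigO.add (isBigO_nu (C := C) (N := 22) (fun n hn => ?_)) he
    have := h n hn
    unfold nu; rwa [inv_pow]
  · simp only; rw [gg_subst_zero, h2 n]; unfold pa; ring

lemma ss_two_asymp : ∃ e : ℕ → ℝ, e =O[atTop] (fun n => nu n ^ 5) ∧ ∀ n,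
    ss 2 n = 7 / 2 * zeta3 + e n := by
  obtain ⟨C, hC, h⟩ := ss_two_close
  refine ⟨fun n => (ss 2 n - 7 / 2 * zeta3), ?_, fun n => by ring⟩
  refine (isBigO_nu (C := C) (N := 26) (fun n hn => ?_))
  have := h n hn
  unfold nu; rwa [inv_pow]

lemma ss_one_asymp : ∃ e : ℕ → ℝ, e =O[atTop] (fun n => nu n ^ 5) ∧ ∀ n, 2 ≤ n → 
    ss 1 n ^ 2 = nu n * (π ^ 3 / 8 * pb (nu n)) + e n := by
  obtain ⟨C, hC, h⟩ := ss_one_close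
  obtain ⟨δ, hδ, h2⟩ := J1_asymp
  obtain ⟨η, hη, h3⟩ := wn_sq_asymp
  set ε : ℕ → ℝ := fun n => ss 1 n - 1 / 2 * ∫ y in Set.Ioi (2:ℝ), gg n 1 y with hε
  have hεO : ε =O[atTop] (fun n => nu n ^ 5) := by
    refine (isBigO_nu (C := C) (N := 24) (fun n hn => ?_))
    have := h n hn
    unfold nu; rwa [inv_pow]
  have hVc : Continuous pV := by unfold pV; fun_prop
  have hBc : Continuous pB := by unfold pB; fun_prop
  have hV := nuO_cont hVc
  have hB := nuO_cont hBc
  have hwO : wn =O[atTop] (fun n => nu n ^ 0) := by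
    refine isBigO_nu (C := 2) (N := 1) (fun n hn => ?_)
    have h1 := wn_sq_upper n hn
    have hn' : (1 : ℝ) ≤ n := by exact_mod_cast hn
    have h4 : π / (2 * n) ≤ 4 := by
      rw [div_le_iff₀ (by positivity)]; nlinarith [pi_le_four]
    rw [pow_zero, mul_one]
    exact abs_le_of_sq_le_sq (by linarith) (by norm_num)
  have hBδ : (fun n => pB (nu n) + δ n) =O[atTop] (fun n => nu n ^ 0) := hB.add (nuO_mono hδ (by norm_num))
  let Q : ℝ → ℝ := fun y => 7109 / 4725 - 2227 / 2160 * y + 527633 / 793800 * y ^ 2 - 363329 / 1587600 * y ^ 3 + 197 / 15876 * y ^ 4 + 38809 / 1587600 * y ^ 5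
  have hQc : Continuous Q := by fun_prop
  have hQ : ∀ y, pV y * pB y ^ 2 - pb y = y ^ 4 * Q y := by
    intro y; simp only [pV, pB, pb, Q]; ring
  refine ⟨fun n => π ^ 3 / 8 * (nu n ^ 5 * Q (nu n) +
      nu n ^ 1 * (η n * ((pB (nu n) + δ n) * (pB (nu n) + δ n))) + nu n ^ 1 * (pV (nu n) * (δ n * (pB (nu n) + (pB (nu n) + δ n)))))
      + (ε n * (ε n + π * (wn n * (pB (nu n) + δ n)))), ?_, fun n hn => ?_⟩
  · refine IsBigO.add (IsBigO.const_mul_left ((IsBigO.add (IsBigO.add ?_ ?_) ?_)) _) ?_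
    · exact nuO_mul 5 (nuO_pow 5) (nuO_cont hQc) (by norm_num)
    · exact nuO_mul 5 (nuO_pow 1) (nuO_mul 4 hη (nuO_mul 0 hBδ hBδ (by norm_num)) (by norm_num)) (by norm_num)
    · exact nuO_mul 5 (nuO_pow 1) (nuO_mul 4 hV (nuO_mul 4 hδ (hB.add hBδ) (by norm_num)) (by norm_num)) (by norm_num)
    · exact nuO_mul 5 hεO ((nuO_mono hεO (by norm_num)).add ((nuO_mul 0 hwO hBδ (by norm_num)).const_mul_left _)) (by norm_num)
  · have e1 : ss 1 n = π / 2 * (wn n * (pB (nu n) + δ n)) + ε n := by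
      simp only [hε]; rw [gg_subst_one, h2 n]; unfold pB; ring
    have e3 : wn n ^ 2 = π / 2 * nu n * (pV (nu n) + η n) := by
      rw [h3 n hn]; unfold pV; ring
    rw [e1]
    have hq := hQ (nu n)
    have hb : pb (nu n) = pV (nu n) * pB (nu n) ^ 2 - nu n ^ 4 * Q (nu n) := by linarith
    rw [hb]
    linear_combination (π ^ 2 / 4 * (pB (nu n) + δ n) ^ 2) * e3

lemma heightVarZ_eq (n : ℕ) (h0 : ss 0 n ≠ 0) :
    heightVarZ n = ss 2 n / ss 0 n - (ss 1 n / ss 0 n) ^ 2 := by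
  have hts : ∀ r : ℕ, ∑' h : ℕ, (h : ℝ) ^ r * (W n h : ℝ) = ∑ h ∈ Finset.range (n + 1), (h : ℝ) ^ r * (W n h : ℝ) := by
    intro r
    refine tsum_eq_sum (fun h hh => ?_)
    rw [W_eq_zero n h (by rw [Finset.mem_range] at hh; omega)]; simp
  have hts0 : ∑' h : ℕ, (W n h : ℝ) = ∑ h ∈ Finset.range (n + 1), (W n h : ℝ) := by
    simpa using hts 0
  unfold heightVarZ heightMomentZ
  rw [hts, hts, hts0]
  have p2 : (2 : ℝ) ^ n ≠ 0 := by positivity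
  set A0 := ∑ h ∈ Finset.range (n + 1), (W n h : ℝ) with hA0
  set A1 := ∑ h ∈ Finset.range (n + 1), (h : ℝ) ^ 1 * (W n h : ℝ) with hA1
  set A2 := ∑ h ∈ Finset.range (n + 1), (h : ℝ) ^ 2 * (W n h : ℝ) with hA2
  have s0 : ss 0 n = A0 / 2 ^ n := by
    simp only [ss, hA0, Finset.sum_div, pow_zero, one_mul]
  have s1 : ss 1 n = (A1 + 2 * A0) / 2 ^ n := by
    simp only [ss, hA0, hA1, Finset.mul_sum, ← Finset.sum_add_distrib, Finset.sum_div]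
    refine Finset.sum_congr rfl (fun h _ => by ring)
  have s2 : ss 2 n = (A2 + 4 * A1 + 4 * A0) / 2 ^ n := by
    simp only [ss, hA0, hA1, hA2, Finset.mul_sum, ← Finset.sum_add_distrib, Finset.sum_div]
    refine Finset.sum_congr rfl (fun h _ => by ring)
  have hA : A0 ≠ 0 := by
    intro h; apply h0; rw [s0, h, zero_div]
  rw [s0, s1, s2]
  field_simp
  ring

/-- the target polynomial -/
noncomputable def pt (y : ℝ) : ℝ :=
  zeta3 * (7 / 2 + 14 / 3 * y - 28 / 45 * y ^ 2 + 8 / 9 * y ^ 3) -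
  π ^ 3 * (1 / 8 + 3 / 16 * y - 67 / 2880 * y ^ 2 + 4189 / 120960 * y ^ 3)

lemma final_num : ∃ e : ℕ → ℝ, e =O[atTop] (fun n => nu n ^ 5) ∧ ∀ n, 2 ≤ n →
    ss 2 n * ss 0 n - ss 1 n ^ 2 - n * pt (nu n) * ss 0 n ^ 2 = e n := by
  obtain ⟨e0, hO0, h0⟩ := ss_zero_asymp
  obtain ⟨e1, hO1, h1⟩ := ss_one_asymp
  obtain ⟨e2, hO2, h2⟩ := ss_two_asymp
  have hac : Continuous pa := by unfold pa; fun_prop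
  have htc : Continuous pt := by unfold pt; fun_prop
  have ha := nuO_cont hac
  have ht := nuO_cont htc
  let Q : ℝ → ℝ := fun y => zeta3 * (34144 / 2025 - 158848 / 6075 * y + 25907584 / 637875 * y ^ 2 - 13413376 / 212625 * y ^ 3 + 1186816 / 70875 * y ^ 4 - 7620608 / 893025 * y ^ 5) +
    π ^ 3 * (-5531 / 6480 + 103247 / 85050 * y - 10409879 / 5953500 * y ^ 2 + 1367161 / 546750 * y ^ 3 - 8613322 / 13395375 * y ^ 4 + 31174538 / 93767625 * y ^ 5)
  have hQc : Continuous Q := by fun_prop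
  have hQ : ∀ y, 7 / 2 * zeta3 * pa y - π ^ 3 / 8 * pb y - pt y * pa y ^ 2 = y ^ 4 * Q y := by
    intro y; simp only [pa, pb, pt, Q]; ring
  have hs0 : (fun n => nu n * pa (nu n) + e0 n) =O[atTop] (fun n => nu n ^ 0) := by
    refine IsBigO.add ?_ (nuO_mono hO0 (by norm_num))
    exact nuO_mul 0 (a := 1) (by simpa using nuO_pow 1) ha (by norm_num)
  have hn1 : (fun n : ℕ => (n : ℝ) * e0 n) =O[atTop] (fun n => nu n ^ 0) := by
    have : (fun n : ℕ => (n : ℝ) * e0 n) =O[atTop] (fun n : ℕ => (n : ℝ) * nu n ^ 5) :=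
      (isBigO_refl _ _).mul hO0
    refine this.trans (isBigO_nu (C := 1) (N := 1) (fun n hn => ?_))
    have hn' : (0 : ℝ) < n := by exact_mod_cast hn
    have : (n : ℝ) * nu n ^ 5 = nu n ^ 4 := by unfold nu; field_simp
    rw [this, abs_of_nonneg (pow_nonneg (nu_nonneg n) 4), pow_zero, mul_one]
    exact pow_le_one₀ (nu_nonneg n) (nu_le n)
  refine ⟨fun n => nu n ^ 5 * Q (nu n) + 7 / 2 * zeta3 * e0 n + e2 n * (nu n * pa (nu n) + e0 n) - e1 n
    - 2 * (e0 n * (pt (nu n) * pa (nu n))) - e0 n * (pt (nu n) * (n * e0 n)), ?_, fun n hn => ?_⟩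
  · refine IsBigO.sub (IsBigO.sub (IsBigO.sub (IsBigO.add (IsBigO.add ?_ ?_) ?_) hO1) ?_) ?_
    · exact nuO_mul 5 (nuO_pow 5) (nuO_cont hQc) (by norm_num)
    · exact hO0.const_mul_left _
    · exact nuO_mul 5 hO2 hs0 (by norm_num)
    · exact (nuO_mul 5 hO0 (nuO_mul 0 ht ha (by norm_num)) (by norm_num)).const_mul_left _
    · exact nuO_mul 5 hO0 (nuO_mul 0 ht hn1 (by norm_num)) (by norm_num)
  · rw [h0, h1 n hn, h2]
    have hn' : (n : ℝ) ≠ 0 := by positivity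
    have hnu : (n : ℝ) * nu n = 1 := by unfold nu; field_simp
    have hq := hQ (nu n)
    linear_combination (nu n) * hq + (-(pt (nu n) * pa (nu n) ^ 2 * nu n) - 2 * pt (nu n) * pa (nu n) * e0 n) * hnu

lemma ss_zero_lower : ∀ᶠ n : ℕ in atTop, nu n / 2 ≤ ss 0 n := by
  obtain ⟨e0, hO0, h0⟩ := ss_zero_asymp
  have hac : Continuous pa := by unfold pa; fun_prop
  obtain ⟨C, hC⟩ := hO0.bound
  have l1 : Tendsto (fun n : ℕ => pa (nu n)) atTop (𝓝 1) := by
    have := (hac.tendsto 0).comp nu_lim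
    simpa [Function.comp_def, pa, nu] using this
  have l2 : Tendsto (fun n : ℕ => C * nu n ^ 4) atTop (𝓝 0) := by
    have := (nu_lim.pow 4).const_mul C
    simpa [nu] using this
  have l3 := l1.sub l2
  rw [sub_zero] at l3
  filter_upwards [hC, l3.eventually (lt_mem_nhds (by norm_num : (1 / 2 : ℝ) < 1))] with n h1 h2
  rw [h0]
  have hnn := nu_nonneg n
  rw [Real.norm_eq_abs, Real.norm_of_nonneg (pow_nonneg hnn 5)] at h1
  have h3 := (abs_le.mp h1).1
  nlinarith [mul_le_mul_of_nonneg_left h2.le hnn]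

end

/-- Asymptotic expansion of the variance of the height of admissible walks on `ℤ`:
`V H̃_n = ((28ζ(3)−π³)/8) n + (224ζ(3)−9π³)/48 − (1792ζ(3)−67π³)/(2880n)
 + (107520ζ(3)−4189π³)/(120960 n²) + O(n^{−3})`. -/
theorem heightVarZ_asymptotics :
    ∃ C > (0 : ℝ), ∃ N₀ : ℕ, ∀ n : ℕ, N₀ ≤ n →
      |heightVarZ n -
          ((28 * zeta3 - π ^ 3) / 8 * n + (224 * zeta3 - 9 * π ^ 3) / 48 -
            (1792 * zeta3 - 67 * π ^ 3) / (2880 * n) +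
            (107520 * zeta3 - 4189 * π ^ 3) / (120960 * (n : ℝ) ^ 2))| ≤
        C / (n : ℝ) ^ 3 := by
  obtain ⟨e, hO, he⟩ := final_num
  obtain ⟨C, hCpos, hC⟩ := hO.exists_pos
  obtain ⟨N, hN⟩ := Filter.eventually_atTop.mp (hC.bound.and ss_zero_lower)
  refine ⟨4 * C, by positivity, max N 2, fun n hn => ?_⟩
  have hn2 : 2 ≤ n := le_trans (le_max_right _ _) hn
  obtain ⟨h1, h2⟩ := hN n (le_trans (le_max_left _ _) hn)
  have hn0 : (0 : ℝ) < n := by exact_mod_cast (by omega : 0 < n)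
  have hnu : 0 < nu n := by unfold nu; positivity
  have hs : 0 < ss 0 n := by linarith
  have h3 := he n hn2
  rw [Real.norm_eq_abs, Real.norm_of_nonneg (by positivity)] at h1
  have et : ((28 * zeta3 - π ^ 3) / 8 * n + (224 * zeta3 - 9 * π ^ 3) / 48 -
            (1792 * zeta3 - 67 * π ^ 3) / (2880 * n) +
            (107520 * zeta3 - 4189 * π ^ 3) / (120960 * (n : ℝ) ^ 2)) = n * pt (nu n) := by
    unfold pt nu; field_simp; ring
  have ev : heightVarZ n - n * pt (nu n) = e n / ss 0 n ^ 2 := by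
    rw [heightVarZ_eq n hs.ne', ← h3]; field_simp
  rw [et, ev, abs_div, abs_of_pos (by positivity : 0 < ss 0 n ^ 2)]
  calc |e n| / ss 0 n ^ 2 ≤ (C * nu n ^ 5) / (nu n / 2) ^ 2 := by gcongr
    _ = 4 * C / (n : ℝ) ^ 3 := by unfold nu; field_simp; norm_num
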